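/- arXiv:math/9901032 — 5 statements merged into one kernel-verified Lean document; each statement's English description precedes it below -/
import Mathlib

section
/- Let s ∈ ℤ and let (k_i)_{i≥1} be a strictly decreasing sequence of integers with k_i = s − i + 1 for all sufficiently large i. Write k_i = a_i + n(b_i − 1) − n·l·m_i with a_i ∈ {1,…,n}, b_i ∈ {1,…,l}, m_i ∈ ℤ. Then for each b ∈ {1,…,l}: the index set {i ≥ 1 : b_i = b} is infinite, the integers a_i − n·m_i for b_i = b are pairwise distinct, and if k^(b)_1 > k^(b)_2 > ⋯ denotes their decreasing enumeration, there exists a unique s_b ∈ ℤ such that k^(b)_i = s_b − i + 1 for all sufficiently large i. Moreover s_1 + s_2 + ⋯ + s_l = s. -/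
/-- Uniqueness of Euclidean division with remainders in `{1, …, n}`. -/
lemma eq_and_eq_of_add_mul_eq {n a a' q q' : ℤ} (ha : 1 ≤ a ∧ a ≤ n) (ha' : 1 ≤ a' ∧ a' ≤ n)
    (h : a + n * q = a' + n * q') : a = a' ∧ q = q' := by
  have hq : q = q' := by
    rcases lt_trichotomy q q' with hlt | heq | hgt
    · nlinarith
    · exact heq
    · nlinarith
  subst hq
  exact ⟨by linarith, rfl⟩

/-- For `c ∈ {1, …, d}`, the number `c - d * m` exceeds `-(d * M)` exactly when `m ≤ M`. -/
lemma neg_mul_lt_sub_mul_iff {d c m M : ℤ} (hc : 1 ≤ c ∧ c ≤ d) :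
    -(d * M) < c - d * m ↔ m ≤ M := by
  constructor
  · intro h
    by_contra! hlt
    nlinarith
  · intro h
    nlinarith

/-- A strictly decreasing integer sequence taking all values `≤ p`, and exactly `c` values
above `p`, equals `p + c - i` for `i ≥ c`. -/
lemma StrictAnti.eq_add_sub_of_ncard {g : ℕ → ℤ} (hg : StrictAnti g) {p : ℤ} {c : ℕ}
    (hp : Set.Iic p ⊆ Set.range g) (hc : (Set.range g ∩ Set.Ioi p).ncard = c) :
    ∀ i ≥ c, g i = p + c - i := by
  obtain ⟨q, hq⟩ := hp (Set.mem_Iic.2 le_rfl)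
  have himage : Set.range g ∩ Set.Ioi p = g '' (Set.Iio q) := by
    ext x
    constructor
    · rintro ⟨⟨i, rfl⟩, hi⟩
      exact ⟨i, hg.lt_iff_gt.1 (hq ▸ hi), rfl⟩
    · rintro ⟨i, hi, rfl⟩
      exact ⟨⟨i, rfl⟩, hq ▸ hg hi⟩
  have hqc : q = c := by
    rw [himage, Set.ncard_image_of_injective _ hg.injective] at hc
    rw [← hc, ← Finset.coe_Iio, Set.ncard_coe_finset, Nat.card_Iio]
  subst hqc
  intro i hi
  induction i, hi using Nat.le_induction with
  | base => simp [hq]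
  | succ i hi ih =>
    have hi' : (q : ℤ) ≤ i := by exact_mod_cast hi
    obtain ⟨j, hj⟩ := hp (show g i - 1 ∈ Set.Iic p from by
      rw [Set.mem_Iic]
      linarith)
    have hij : i < j := hg.lt_iff_gt.1 (by linarith)
    have hle : g j ≤ g (i + 1) := hg.antitone hij
    have hlt : g (i + 1) < g i := hg (Nat.lt_succ_self i)
    push_cast
    omega


/-!
STATEMENT 0. Fix integers `n > 1`, `l > 1`. Every integer `k` is written uniquely as
`k = a + n(b-1) - n*l*m` with `a ∈ {1,…,n}`, `b ∈ {1,…,l}`, `m ∈ ℤ`; we take the data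
`a i, b i, m i` of this decomposition of `k i` as hypotheses.

The sequence `(k i)_{i ≥ 0}` (0-indexed: `k i` is the paper's `k_{i+1}`) is strictly
decreasing with `k i = s - i` eventually (the paper's `k_i = s - i + 1`).  For every
`b₀ ∈ {1,…,l}`: the index set `{i : b i = b₀}` is infinite, the values `a i - n * m i`
(for `b i = b₀`) are pairwise distinct, and any strictly decreasing enumeration `g` of
this set of values eventually satisfies `g i = s_{b₀} - i` for a unique `s_{b₀}`;
moreover `s_1 + ⋯ + s_l = s`.
-/
theorem stmt_0 (n l : ℤ) (hn : 1 < n) (hl : 1 < l) (s : ℤ)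
    (k a b m : ℕ → ℤ)
    (hdec : ∀ i, k (i + 1) < k i)
    (hev : ∃ N : ℕ, ∀ i ≥ N, k i = s - i)
    (ha : ∀ i, 1 ≤ a i ∧ a i ≤ n)
    (hb : ∀ i, 1 ≤ b i ∧ b i ≤ l)
    (hk : ∀ i, k i = a i + n * (b i - 1) - n * l * m i) :
    ∃ t : ℤ → ℤ,
      (∀ b₀ : ℤ, 1 ≤ b₀ → b₀ ≤ l →
        ({i : ℕ | b i = b₀}.Infinite ∧
        (∀ i j : ℕ, b i = b₀ → b j = b₀ →
          a i - n * m i = a j - n * m j → i = j) ∧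
        (∀ g : ℕ → ℤ, StrictAnti g →
          Set.range g = {x : ℤ | ∃ i : ℕ, b i = b₀ ∧ x = a i - n * m i} →
          ((∃ N : ℕ, ∀ i ≥ N, g i = t b₀ - i) ∧
           ∀ s' : ℤ, (∃ N : ℕ, ∀ i ≥ N, g i = s' - i) → s' = t b₀)))) ∧
      (∑ b₀ ∈ Finset.Icc 1 l, t b₀) = s := by
  obtain ⟨N, hN⟩ := hev
  have hanti : StrictAnti k := strictAnti_nat_of_succ_lt hdec
  have hc (i) : 1 ≤ a i + n * (b i - 1) ∧ a i + n * (b i - 1) ≤ n * l := by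
    have := ha i
    have := hb i
    constructor <;> nlinarith
  have hnl : 1 ≤ n * l := by nlinarith
  obtain ⟨M, R, hNR, hR⟩ : ∃ (M : ℤ) (R : ℕ), N ≤ R ∧ (R : ℤ) = s + n * l * M := by
    have hM : 0 ≤ (N : ℤ) + |s| := by positivity
    have hle : (N : ℤ) ≤ s + n * l * (N + |s|) := by nlinarith [neg_abs_le s]
    exact ⟨N + |s|, (s + n * l * (N + |s|)).toNat, by omega, by omega⟩
  have hlt (i) : i < R ↔ m i ≤ M := by
    rw [← neg_mul_lt_sub_mul_iff (hc i), ← hk, ← hanti.lt_iff_gt, hN R hNR, hR]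
    ring_nf
  have hinj (b₀ : ℤ) (i j : ℕ) (hi : b i = b₀) (hj : b j = b₀)
      (h : a i - n * m i = a j - n * m j) : i = j := by
    obtain ⟨h₁, h₂⟩ := eq_and_eq_of_add_mul_eq (q := -m i) (q' := -m j) (ha i) (ha j)
      (by linarith)
    exact hanti.injective (by rw [hk i, hk j, hi, hj, h₁, neg_inj.1 h₂])
  have hsurj (b₀ : ℤ) (h₁ : 1 ≤ b₀) (h₂ : b₀ ≤ l) :
      Set.Iic (-(n * M)) ⊆ {x : ℤ | ∃ i : ℕ, b i = b₀ ∧ x = a i - n * m i} := by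
    intro x hx
    obtain ⟨a₀, m₀, ha₀, rfl⟩ : ∃ a₀ m₀ : ℤ, (1 ≤ a₀ ∧ a₀ ≤ n) ∧ x = a₀ - n * m₀ := by
      have := Int.emod_nonneg (x - 1) (show n ≠ 0 by omega)
      have := Int.emod_lt_of_pos (x - 1) (show 0 < n by omega)
      have := Int.emod_add_mul_ediv (x - 1) n
      exact ⟨(x - 1) % n + 1, -((x - 1) / n), ⟨by omega, by omega⟩, by linarith⟩
    have hm₀ : ¬ m₀ ≤ M := fun h ↦ not_lt.2 hx ((neg_mul_lt_sub_mul_iff ha₀).2 h)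
    have hc₀ : 1 ≤ a₀ + n * (b₀ - 1) ∧ a₀ + n * (b₀ - 1) ≤ n * l := by
      constructor <;> nlinarith
    rw [← neg_mul_lt_sub_mul_iff hc₀, not_lt] at hm₀
    obtain ⟨i, hi⟩ : ∃ i : ℕ, (i : ℤ) = s - (a₀ + n * (b₀ - 1) - n * l * m₀) :=
      ⟨_, Int.toNat_of_nonneg (by omega)⟩
    have hki := hN i (by omega)
    rw [hk i] at hki
    obtain ⟨h₃, h₄⟩ := eq_and_eq_of_add_mul_eq (q := b i - 1 - l * m i)
      (q' := b₀ - 1 - l * m₀) (ha i) ha₀ (by linarith)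
    obtain ⟨h₅, h₆⟩ := eq_and_eq_of_add_mul_eq (q := -m i) (q' := -m₀) (hb i) ⟨h₁, h₂⟩
      (by linarith)
    exact ⟨i, h₅, by rw [h₃, neg_inj.1 h₆]⟩
  refine ⟨fun b₀ ↦ -(n * M) + ({i ∈ Finset.range R | b i = b₀}.card : ℤ),
    fun b₀ h₁ h₂ ↦ ⟨?_, hinj b₀, fun g hg hrange ↦ ?_⟩, ?_⟩
  · intro hfin
    refine Set.Iic_infinite (-(n * M)) ((hfin.image fun i ↦ a i - n * m i).subset ?_)
    intro x hx
    obtain ⟨i, hi, rfl⟩ := hsurj b₀ h₁ h₂ hx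
    exact ⟨i, hi, rfl⟩
  · have hcard : (Set.range g ∩ Set.Ioi (-(n * M))).ncard
        = {i ∈ Finset.range R | b i = b₀}.card := by
      have himage : Set.range g ∩ Set.Ioi (-(n * M))
          = (fun i ↦ a i - n * m i) '' ({i ∈ Finset.range R | b i = b₀} : Finset ℕ) := by
        rw [hrange]
        ext x
        constructor
        · rintro ⟨⟨i, hi, rfl⟩, hx⟩
          refine ⟨i, ?_, rfl⟩
          simpa [hi, hlt] using (neg_mul_lt_sub_mul_iff (ha i)).1 hx
        · rintro ⟨i, hi, rfl⟩
          simp only [Finset.coe_filter, Finset.mem_range, Set.mem_ofPred_eq] at hi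
          exact ⟨⟨i, hi.2, rfl⟩, (neg_mul_lt_sub_mul_iff (ha i)).2 ((hlt i).1 hi.1)⟩
      rw [himage, Set.InjOn.ncard_image, Set.ncard_coe_finset]
      intro i hi j hj h
      simp only [Finset.coe_filter, Set.mem_ofPred_eq] at hi hj
      exact hinj b₀ i j hi.2 hj.2 h
    have hev := hg.eq_add_sub_of_ncard (hrange ▸ hsurj b₀ h₁ h₂) hcard
    refine ⟨⟨_, hev⟩, ?_⟩
    rintro s' ⟨N', hN'⟩
    have e₁ := hev _ (le_max_left _ N')
    have e₂ := hN' _ (le_max_right {i ∈ Finset.range R | b i = b₀}.card _)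
    linarith
  · have hcount := Finset.card_eq_sum_card_fiberwise (s := Finset.range R) (f := b)
      (t := Finset.Icc 1 l) fun i _ ↦ by simpa using hb i
    rw [Finset.card_range] at hcount
    rw [Finset.sum_add_distrib, ← Nat.cast_sum, ← hcount, hR, Finset.sum_const, Int.card_Icc,
      nsmul_eq_mul, Int.toNat_of_nonneg (by omega)]
    ring
end

section
/- The map ι_l : Π × ℤ → Π^l × ℤ^l, (λ, s) ↦ ((λ^(1),…,λ^(l)), (s_1,…,s_l)), is a bijection; moreover for each fixed s ∈ ℤ it restricts to a bijection from Π × {s} onto {((λ^(1),…,λ^(l)), (s_1,…,s_l)) ∈ Π^l × ℤ^l : s_1 + ⋯ + s_l = s}. -/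
/-!
STATEMENT 1.  Fix `n > 1`, `l > 1`.  A partition is an antitone, eventually zero
sequence `ℕ → ℕ` (0-indexed: `λ.1 i` is the paper's `λ_{i+1}`).

Every integer `k` is uniquely `k = a + n(b-1) - n*l*m` with `a ∈ {1,…,n}`,
`b ∈ {1,…,l}`, `m ∈ ℤ`; the coordinates are given by `aC`, `bC`, `mC` below.

Given `(λ, s)`, put `k i = λ_{i+1} + s - i` (the paper's `k_{i+1} = λ_{i+1} + s - i`).
`IotaLSpec n l λ s λT sT` says that for each `b ∈ {1,…,l}` (encoded as `b : Fin l`,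
representing `b+1`), the strictly decreasing sequence `i ↦ λT(b)_{i+1} + sT b - i`
enumerates the set `{a_i - n m_i : b_i = b}`: this is exactly the defining property
of `ι_l (λ, s) = (λT, sT)`.

The theorem: there is a map `ι` satisfying this specification, it is a bijection
`Π × ℤ → Π^l × ℤ^l`, and for each fixed `s` it restricts to a bijection from
`Π × {s}` onto `{(λT, sT) : Σ_b sT b = s}`.
-/

def Ptn : Type := {f : ℕ → ℕ // Antitone f ∧ ∃ N : ℕ, ∀ i ≥ N, f i = 0}

/-- the `a`-coordinate of `k`: `a ∈ {1,…,n}` with `k ≡ a + n(b-1) (mod n*l)`. -/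
def aC (n k : ℤ) : ℤ := (k - 1) % n + 1

/-- the `b`-coordinate of `k`. -/
def bC (n l k : ℤ) : ℤ := (k - 1) % (n * l) / n + 1

/-- the `m`-coordinate of `k`, so that `k = a + n(b-1) - n*l*m`. -/
def mC (n l k : ℤ) : ℤ := (aC n k + n * (bC n l k - 1) - k) / (n * l)

/-- The defining property of `ι_l (λ, s) = (λT, sT)`. -/
def IotaLSpec (n l : ℕ) (lam : Ptn) (s : ℤ) (lamT : Fin l → Ptn) (sT : Fin l → ℤ) :
    Prop :=
  ∀ b : Fin l,
    Set.range (fun i : ℕ => ((lamT b).1 i : ℤ) + sT b - i) =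
      {x : ℤ | ∃ i : ℕ,
        bC n l ((lam.1 i : ℤ) + s - i) = (b : ℤ) + 1 ∧
        x = aC n ((lam.1 i : ℤ) + s - i)
              - n * mC n l ((lam.1 i : ℤ) + s - i)}

/-- The beta-set (Maya diagram) of a charged partition. -/
def betaSet (p : Ptn × ℤ) : Set ℤ := Set.range fun i : ℕ => (p.1.1 i : ℤ) + p.2 - i

/-- A Maya diagram is bounded above and contains all sufficiently negative integers. -/
def IsMaya (S : Set ℤ) : Prop := (∃ u, ∀ x ∈ S, x ≤ u) ∧ ∃ v, ∀ x ≤ v, x ∈ S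

theorem isMaya_betaSet (p : Ptn × ℤ) : IsMaya (betaSet p) := by
  obtain ⟨⟨f, hf, N, hN⟩, s⟩ := p
  refine ⟨⟨f 0 + s, ?_⟩, s - N, fun x hx => ⟨(s - x).toNat, ?_⟩⟩
  · rintro _ ⟨i, rfl⟩
    have := hf (Nat.zero_le i)
    dsimp only
    omega
  · have := hN (s - x).toNat (by omega)
    dsimp only
    omega

theorem betaSet_injective : Function.Injective betaSet := by
  have anti (p : Ptn × ℤ) : StrictAnti fun i : ℕ => (p.1.1 i : ℤ) + p.2 - i := by
    intro i j hij
    have := p.1.2.1 hij.le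
    dsimp only
    omega
  intro p p' h
  have hk : (fun i : ℕ => (p.1.1 i : ℤ) + p.2 - i) = fun i : ℕ => (p'.1.1 i : ℤ) + p'.2 - i :=
    (StrictMono.range_inj (γ := ℤᵒᵈ) (anti p).dual_right (anti p').dual_right).1 h
  obtain ⟨⟨f, hf, N, hN⟩, s⟩ := p
  obtain ⟨⟨f', hf', N', hN'⟩, s'⟩ := p'
  have key (i : ℕ) : (f i : ℤ) + s - i = f' i + s' - i := congrFun hk i
  have hs : s = s' := by
    have h₁ := hN (max N N') (le_max_left _ _)
    have h₂ := hN' (max N N') (le_max_right _ _)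
    have h₃ := key (max N N')
    omega
  subst hs
  have hff : f = f' := funext fun i => by
    have := key i
    omega
  subst hff
  rfl

theorem IsMaya.exists_betaSet_eq {S : Set ℤ} (hS : IsMaya S) : ∃ p, betaSet p = S := by
  classical
  obtain ⟨⟨u, hu⟩, v, hv⟩ := hS
  let T : ℕ → Prop := fun t => u - t ∈ S
  let t₀ := (u - v).toNat
  have hT (i : ℕ) : T (t₀ + i) := hv _ (by push_cast; omega)
  have hinf : (Set.ofPred T).Infinite :=
    Set.infinite_of_injective_forall_mem (add_right_injective t₀) hT
  have hcount (i : ℕ) : Nat.count T (t₀ + i) = Nat.count T t₀ + i := by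
    induction i with
    | zero => rfl
    | succ i ih => rw [← add_assoc, Nat.count_succ, if_pos (hT i), ih, add_assoc]
  have hnth (i : ℕ) : Nat.nth T (Nat.count T t₀ + i) = t₀ + i := by
    rw [← hcount, Nat.nth_count (hT i)]
  have hmono : Monotone fun i => (Nat.nth T i : ℤ) - i := by
    refine monotone_nat_of_le_succ fun i => ?_
    have := Nat.nth_strictMono hinf (Nat.lt_add_one i)
    push_cast
    omega
  have hle (i : ℕ) : (Nat.nth T i : ℤ) - i ≤ t₀ - Nat.count T t₀ := by
    have h₁ := hmono (Nat.le_add_left i (Nat.count T t₀))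
    have h₂ := hnth i
    dsimp only at h₁
    push_cast at h₁
    omega
  let s : ℤ := u - t₀ + Nat.count T t₀
  let f : ℕ → ℕ := fun i => (u - Nat.nth T i - s + i).toNat
  have hf (i : ℕ) : (f i : ℤ) + s - i = u - Nat.nth T i := by
    have := hle i
    simp only [f, s]
    omega
  refine ⟨⟨⟨f, fun i j hij => ?_, Nat.count T t₀, fun i hi => ?_⟩, s⟩, ?_⟩
  · have h₁ := hmono hij
    have h₂ := hf i
    have h₃ := hf j
    dsimp only at h₁
    omega
  · obtain ⟨j, rfl⟩ := Nat.exists_eq_add_of_le hi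
    have h₁ := hf (Nat.count T t₀ + j)
    rw [hnth] at h₁
    simp only [s] at h₁
    push_cast at h₁
    omega
  · ext x
    simp only [betaSet, Set.mem_range, hf]
    constructor
    · rintro ⟨i, rfl⟩
      exact Nat.nth_mem_of_infinite hinf i
    · intro hx
      have hx' : T (u - x).toNat := by
        have := hu x hx
        have e : u - ((u - x).toNat : ℤ) = x := by omega
        simpa only [T, e] using hx
      refine ⟨Nat.count T (u - x).toNat, ?_⟩
      rw [Nat.nth_count hx']
      have := hu x hx
      omega

theorem IsMaya.finite_inter_Ioi {S : Set ℤ} (hS : IsMaya S) (M : ℤ) : (S ∩ Set.Ioi M).Finite := by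
  obtain ⟨⟨u, hu⟩, -⟩ := hS
  exact (Set.finite_Ioc M u).subset fun x hx => ⟨hx.2, hu x hx.1⟩

/-- The charge is read off by counting the elements of the beta-set above a low enough level. -/
theorem exists_ncard_betaSet_inter_Ioi (p : Ptn × ℤ) :
    ∃ M₀, ∀ M ≤ M₀, ((betaSet p ∩ Set.Ioi M).ncard : ℤ) = p.2 - M := by
  obtain ⟨⟨f, hf, N, hN⟩, s⟩ := p
  refine ⟨s - N, fun M hM => ?_⟩
  have himage : betaSet (⟨f, hf, N, hN⟩, s) ∩ Set.Ioi M =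
      (fun i : ℕ => (f i : ℤ) + s - i) '' Set.Iio (s - M).toNat := by
    ext x
    constructor
    · rintro ⟨⟨i, rfl⟩, hi⟩
      refine ⟨i, ?_, rfl⟩
      simp only [Set.mem_Ioi, Set.mem_Iio] at hi ⊢
      by_contra hlt
      have := hN i (by omega)
      omega
    · rintro ⟨i, hi, rfl⟩
      refine ⟨⟨i, rfl⟩, ?_⟩
      simp only [Set.mem_Ioi, Set.mem_Iio] at hi ⊢
      omega
  have hinj : Function.Injective fun i : ℕ => (f i : ℤ) + s - i := by
    refine StrictAnti.injective fun i j hij => ?_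
    have := hf hij.le
    omega
  rw [himage, Set.ncard_image_of_injective _ hinj, ← Finset.coe_Iio, Set.ncard_coe_finset,
    Nat.card_Iio]
  omega

/-- The integer `k` whose coordinates satisfy `b = c + 1` and `a - n * m = x`. -/
def unsplit (n l c x : ℤ) : ℤ := (x - 1) % n + 1 + n * c + n * l * ((x - 1) / n)

section Coordinates

variable {n l : ℤ}

theorem coords_eq {c r t : ℤ} (hc : 0 ≤ c) (hcl : c < l) (hr : 0 ≤ r) (hrn : r < n) :
    aC n (r + 1 + n * c + n * l * t) = r + 1 ∧ bC n l (r + 1 + n * c + n * l * t) = c + 1 ∧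
      mC n l (r + 1 + n * c + n * l * t) = -t := by
  have hn : 0 < n := by omega
  have hl : 0 < l := by omega
  have hnl : 0 < n * l := mul_pos hn hl
  have ha : aC n (r + 1 + n * c + n * l * t) = r + 1 := by
    rw [aC, show r + 1 + n * c + n * l * t - 1 = r + n * (c + l * t) by ring,
      Int.add_mul_emod_self_left, Int.emod_eq_of_lt hr hrn]
  have hb : bC n l (r + 1 + n * c + n * l * t) = c + 1 := by
    rw [bC, show r + 1 + n * c + n * l * t - 1 = r + n * c + n * l * t by ring,
      Int.add_mul_emod_self_left, Int.emod_eq_of_lt (by positivity) (by nlinarith),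
      Int.add_mul_ediv_left _ _ hn.ne', Int.ediv_eq_zero_of_lt hr hrn, zero_add]
  refine ⟨ha, hb, ?_⟩
  rw [mC, ha, hb, show r + 1 + n * (c + 1 - 1) - (r + 1 + n * c + n * l * t) = n * l * -t by ring,
    Int.mul_ediv_cancel_left _ hnl.ne']

theorem coords_unsplit (hn : 0 < n) {c : ℤ} (hc : 0 ≤ c) (hcl : c < l) (x : ℤ) :
    bC n l (unsplit n l c x) = c + 1 ∧
      aC n (unsplit n l c x) - n * mC n l (unsplit n l c x) = x := by
  obtain ⟨ha, hb, hm⟩ := coords_eq (t := (x - 1) / n) hc hcl (Int.emod_nonneg (x - 1) hn.ne')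
    (Int.emod_lt_of_pos _ hn)
  refine ⟨hb, ?_⟩
  rw [unsplit, ha, hm]
  linarith [Int.emod_add_mul_ediv (x - 1) n]

theorem exists_unsplit_eq (hn : 0 < n) (hl : 0 < l) (k : ℤ) :
    ∃ c x, 0 ≤ c ∧ c < l ∧ unsplit n l c x = k := by
  refine ⟨(k - 1) / n % l, (k - 1) % n + n * ((k - 1) / n / l) + 1, Int.emod_nonneg _ hl.ne',
    Int.emod_lt_of_pos _ hl, ?_⟩
  rw [unsplit, add_sub_cancel_right, Int.add_mul_emod_self_left, Int.emod_emod,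
    Int.add_mul_ediv_left _ _ hn.ne', Int.ediv_eq_zero_of_lt (Int.emod_nonneg _ hn.ne')
    (Int.emod_lt_of_pos _ hn)]
  linear_combination Int.emod_add_mul_ediv (k - 1) n + n * Int.emod_add_mul_ediv ((k - 1) / n) l

theorem lt_unsplit_iff (hn : 0 < n) {c : ℤ} (hc : 0 ≤ c) (hcl : c < l) (x q : ℤ) :
    n * l * q < unsplit n l c x ↔ n * q < x := by
  have h₀ := Int.emod_nonneg (x - 1) hn.ne'
  have h₁ := Int.emod_lt_of_pos (x - 1) hn
  have h₂ := Int.emod_add_mul_ediv (x - 1) n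
  have hl : 0 < l := by omega
  have hnl : 0 < n * l := mul_pos hn hl
  have hiff : n * q < x ↔ q ≤ (x - 1) / n := by
    rw [Int.le_ediv_iff_mul_le hn, mul_comm]
    omega
  rw [hiff, unsplit]
  constructor
  · intro h
    by_contra! hq
    have : n * l * ((x - 1) / n + 1) ≤ n * l * q := by gcongr; omega
    nlinarith
  · intro h
    have : n * l * q ≤ n * l * ((x - 1) / n) := by gcongr
    have : 0 ≤ n * c := by positivity
    omega

end Coordinates

section Split

variable {n l : ℕ}

theorem unsplit_bijective (hn : 0 < n) (hl : 0 < l) :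
    Function.Bijective fun y : Fin l × ℤ => unsplit n l (y.1 : ℕ) y.2 := by
  constructor
  · rintro ⟨b, x⟩ ⟨b', x'⟩ h
    dsimp only at h
    have h₁ := coords_unsplit (n := n) (l := l) (c := (b : ℕ)) (by omega) (by omega) (by omega) x
    have h₂ := coords_unsplit (n := n) (l := l) (c := (b' : ℕ)) (by omega) (by omega) (by omega) x'
    rw [h] at h₁
    refine Prod.ext (Fin.ext ?_) (h₁.2.symm.trans h₂.2)
    have := h₁.1.symm.trans h₂.1
    dsimp only
    omega
  · intro k
    obtain ⟨c, x, hc, hcl, h⟩ := exists_unsplit_eq (n := n) (l := l) (by omega) (by omega) k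
    lift c to ℕ using hc
    exact ⟨(⟨c, by omega⟩, x), h⟩

theorem iotaLSpec_iff (hn : 0 < n) (hl : 0 < l) (p : Ptn × ℤ) (lamT : Fin l → Ptn)
    (sT : Fin l → ℤ) :
    IotaLSpec n l p.1 p.2 lamT sT ↔
      ∀ b : Fin l, betaSet (lamT b, sT b) = unsplit n l (b : ℕ) ⁻¹' betaSet p := by
  refine forall_congr' fun b => ?_
  have hset : {x : ℤ | ∃ i : ℕ, bC n l ((p.1.1 i : ℤ) + p.2 - i) = ((b : ℕ) : ℤ) + 1 ∧
      x = aC n ((p.1.1 i : ℤ) + p.2 - i) - n * mC n l ((p.1.1 i : ℤ) + p.2 - i)} =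
      unsplit n l (b : ℕ) ⁻¹' betaSet p := by
    ext x
    simp only [Set.mem_ofPred_eq, Set.mem_preimage, betaSet, Set.mem_range]
    refine exists_congr fun i => ?_
    obtain ⟨⟨b', x'⟩, h⟩ := (unsplit_bijective hn hl).2 ((p.1.1 i : ℤ) + p.2 - i)
    dsimp only at h
    obtain ⟨h₁, h₂⟩ := coords_unsplit (n := n) (l := l) (c := (b' : ℕ)) (by omega) (by omega)
      (by omega) x'
    rw [← h, h₁, h₂]
    constructor
    · rintro ⟨hb, rfl⟩
      rw [show (b' : ℕ) = b by omega]
    · intro h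
      have := (unsplit_bijective hn hl).1 (a₁ := (b', x')) (a₂ := (b, x)) h
      simp_all
  rw [hset]
  rfl

theorem IsMaya.preimage_unsplit (hn : 0 < n) {S : Set ℤ} (hS : IsMaya S) (b : Fin l) :
    IsMaya (unsplit n l (b : ℕ) ⁻¹' S) := by
  have hnl : 0 < (n : ℤ) * l := by
    have := b.pos
    positivity
  have hlt (x q : ℤ) := lt_unsplit_iff (n := n) (l := l) (c := (b : ℕ)) (by omega) (by omega)
    (by omega) x q
  obtain ⟨⟨u, hu⟩, v, hv⟩ := hS
  refine ⟨⟨n * |u|, fun x hx => ?_⟩, n * -|v|, fun x hx => hv _ ?_⟩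
  · rw [← not_lt, ← hlt, not_lt]
    have := hu _ hx
    nlinarith [le_abs_self u, abs_nonneg u]
  · rw [← not_lt, ← hlt, not_lt] at hx
    nlinarith [neg_abs_le v, abs_nonneg v]

theorem isMaya_iUnion_image_unsplit (hn : 0 < n) (hl : 0 < l) {S : Fin l → Set ℤ}
    (hS : ∀ b, IsMaya (S b)) : IsMaya (⋃ b : Fin l, unsplit n l (b : ℕ) '' S b) := by
  have hlt (b : Fin l) (x q : ℤ) := lt_unsplit_iff (n := n) (l := l) (c := (b : ℕ)) (by omega)
    (by omega) (by omega) x q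
  choose u hu using fun b => (hS b).1
  choose v hv using fun b => (hS b).2
  obtain ⟨U, hU⟩ := Finite.exists_le u
  obtain ⟨V, hV⟩ := Finite.exists_ge v
  refine ⟨⟨n * l * |U|, fun k hk => ?_⟩, n * l * -|V|, fun k hk => ?_⟩
  · obtain ⟨b, x, hx, rfl⟩ := Set.mem_iUnion.1 hk
    rw [← not_lt, hlt, not_lt]
    have := hu b x hx
    have := hU b
    nlinarith [le_abs_self U, abs_nonneg U]
  · obtain ⟨⟨b, x⟩, rfl⟩ := (unsplit_bijective hn hl).2 k
    refine Set.mem_iUnion.2 ⟨b, x, hv b x ?_, rfl⟩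
    rw [← not_lt, hlt, not_lt] at hk
    have := hV b
    nlinarith [neg_abs_le V, abs_nonneg V]

theorem sum_ncard_preimage_unsplit (hn : 0 < n) (hl : 0 < l) {S : Set ℤ} (hS : IsMaya S) (q : ℤ) :
    ∑ b : Fin l, (unsplit n l (b : ℕ) ⁻¹' S ∩ Set.Ioi (n * q)).ncard =
      (S ∩ Set.Ioi (n * l * q)).ncard := by
  have hlt (b : Fin l) (x : ℤ) := lt_unsplit_iff (n := n) (l := l) (c := (b : ℕ)) (by omega)
    (by omega) (by omega) x q
  have hbij := unsplit_bijective hn hl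
  have (b : Fin l) : Finite ↥(unsplit n l (b : ℕ) ⁻¹' S ∩ Set.Ioi (n * q)) :=
    (hS.preimage_unsplit hn b).finite_inter_Ioi _
  simp only [← Nat.card_coe_set_eq]
  rw [← Nat.card_sigma]
  refine Nat.card_congr (Equiv.ofBijective
    (fun y => ⟨unsplit n l (y.1 : ℕ) y.2, y.2.2.1, (hlt y.1 y.2).2 y.2.2.2⟩) ⟨?_, ?_⟩)
  · rintro ⟨b, x, hx⟩ ⟨b', x', hx'⟩ h
    obtain ⟨rfl, rfl⟩ := Prod.mk.inj (hbij.1 (a₁ := (b, x)) (a₂ := (b', x')) (congrArg Subtype.val h))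
    rfl
  · rintro ⟨k, hk, hq⟩
    obtain ⟨⟨b, x⟩, rfl⟩ := hbij.2 k
    exact ⟨⟨b, x, hk, (hlt b x).1 hq⟩, rfl⟩

theorem sum_charge_eq (hn : 0 < n) (hl : 0 < l) {p : Ptn × ℤ} {r : Fin l → Ptn × ℤ}
    (h : ∀ b, betaSet (r b) = unsplit n l (b : ℕ) ⁻¹' betaSet p) : ∑ b, (r b).2 = p.2 := by
  obtain ⟨M, hM⟩ := exists_ncard_betaSet_inter_Ioi p
  choose M' hM' using fun b => exists_ncard_betaSet_inter_Ioi (r b)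
  obtain ⟨V, hV⟩ := Finite.exists_ge M'
  obtain ⟨q, hq₀, hqM, hqV⟩ : ∃ q : ℤ, q ≤ 0 ∧ q ≤ M ∧ q ≤ V :=
    ⟨min 0 (min M V), by omega, by omega, by omega⟩
  have hnq : (n : ℤ) * q ≤ q := by nlinarith
  have hnlq : (n : ℤ) * l * q ≤ q := by
    have : 0 < (n : ℤ) * l := by positivity
    nlinarith
  have hsum := congrArg (Nat.cast : ℕ → ℤ)
    (sum_ncard_preimage_unsplit hn hl (isMaya_betaSet p) q)
  rw [hM _ (by omega)] at hsum
  push_cast at hsum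
  simp only [← h] at hsum
  rw [Finset.sum_congr rfl fun b _ => hM' b (n * q) (by have := hV b; omega)] at hsum
  simp only [Finset.sum_sub_distrib, Finset.sum_const, Finset.card_univ, Fintype.card_fin,
    nsmul_eq_mul] at hsum
  linear_combination hsum

end Split

theorem stmt_1 (n l : ℕ) (hn : 1 < n) (hl : 1 < l) :
    ∃ ι : Ptn × ℤ → (Fin l → Ptn) × (Fin l → ℤ),
      (∀ p : Ptn × ℤ, IotaLSpec n l p.1 p.2 (ι p).1 (ι p).2) ∧
      Function.Bijective ι ∧
      (∀ s : ℤ, Set.BijOn ι {p : Ptn × ℤ | p.2 = s}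
        {q : (Fin l → Ptn) × (Fin l → ℤ) | (∑ b, q.2 b) = s}) := by
  have hn₀ : 0 < n := by omega
  have hl₀ : 0 < l := by omega
  choose r hr using fun (p : Ptn × ℤ) (b : Fin l) =>
    ((isMaya_betaSet p).preimage_unsplit hn₀ b).exists_betaSet_eq
  have hbij := unsplit_bijective hn₀ hl₀
  have hinj : Function.Injective fun p => ((fun b => (r p b).1, fun b => (r p b).2) :
      (Fin l → Ptn) × (Fin l → ℤ)) := by
    intro p p' h
    obtain ⟨h₁, h₂⟩ := Prod.mk.inj h
    apply betaSet_injective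
    ext k
    obtain ⟨⟨b, x⟩, rfl⟩ := hbij.2 k
    have hb : r p b = r p' b := Prod.ext (congrFun h₁ b) (congrFun h₂ b)
    exact Set.ext_iff.1 ((hr p b).symm.trans ((congrArg betaSet hb).trans (hr p' b))) x
  have hsurj : Function.Surjective fun p => ((fun b => (r p b).1, fun b => (r p b).2) :
      (Fin l → Ptn) × (Fin l → ℤ)) := by
    rintro ⟨lamT, sT⟩
    obtain ⟨p, hp⟩ := (isMaya_iUnion_image_unsplit hn₀ hl₀
      fun b => isMaya_betaSet (lamT b, sT b)).exists_betaSet_eq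
    have hb (b : Fin l) : r p b = (lamT b, sT b) := by
      apply betaSet_injective
      rw [hr, hp]
      ext x
      constructor
      · intro hx
        obtain ⟨b', x', hx', h⟩ := Set.mem_iUnion.1 hx
        obtain ⟨rfl, rfl⟩ := Prod.mk.inj (hbij.1 (a₁ := (b', x')) (a₂ := (b, x)) h)
        exact hx'
      · exact fun hx => Set.mem_iUnion.2 ⟨b, x, hx, rfl⟩
    exact ⟨p, by simp only [hb]⟩
  have hsum (p : Ptn × ℤ) : ∑ b, (r p b).2 = p.2 := sum_charge_eq hn₀ hl₀ (hr p)
  refine ⟨fun p => (fun b => (r p b).1, fun b => (r p b).2),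
    fun p => (iotaLSpec_iff hn₀ hl₀ p _ _).2 (hr p), ⟨hinj, hsurj⟩, fun s =>
    ⟨fun p hp => (hsum p).trans hp, hinj.injOn, fun q hq => ?_⟩⟩
  obtain ⟨p, rfl⟩ := hsurj q
  exact ⟨p, (hsum p).symm.trans hq, rfl⟩
end

section
/- For every (λ_l, s_l) ∈ Π^l × ℤ^l, the integers Φ_j(λ_l, s_l) := #{i < j : b_i < b_j} − #{i < j : b°_i < b°_j} vanish for all sufficiently large j; consequently Φ(λ_l, s_l) := Σ_{j≥1} Φ_j(λ_l, s_l) is a well-defined integer. -/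
/-- The empty (zero) partition. -/
def emptyPtn : Ptn := ⟨fun _ => 0, fun _ _ _ => le_rfl, 0, fun _ _ => rfl⟩

theorem bC_mem_Icc {n l : ℕ} (hn : 0 < n) (hl : 0 < l) (k : ℤ) :
    bC n l k ∈ Finset.Icc (1 : ℤ) l := by
  have hn' : (0 : ℤ) < n := by exact_mod_cast hn
  have hl' : (0 : ℤ) < l := by exact_mod_cast hl
  have h0 := Int.emod_nonneg (k - 1) (mul_pos hn' hl').ne'
  have h1 := Int.emod_lt_of_pos (k - 1) (mul_pos hn' hl')
  have h2 := Int.ediv_nonneg h0 hn'.le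
  have h3 : (k - 1) % (n * l) / n < l := Int.ediv_lt_of_lt_mul hn' (by rwa [mul_comm (l : ℤ)])
  rw [Finset.mem_Icc, bC]
  omega

theorem emod_add_mul_emod_mul_ediv (n l K : ℤ) :
    K % n + n * (K % (n * l) / n) = K % (n * l) := by
  rw [← Int.emod_emod_of_dvd K (Dvd.intro l rfl : n ∣ n * l)]
  exact Int.emod_add_mul_ediv _ _

theorem mC_eq {n l : ℤ} (hn : 0 < n) (hl : 0 < l) (k : ℤ) :
    mC n l k = -((k - 1) / (n * l)) := by
  have h1 := emod_add_mul_emod_mul_ediv n l (k - 1)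
  have h2 := Int.emod_add_mul_ediv (k - 1) (n * l)
  have h3 : aC n k + n * (bC n l k - 1) - k = n * l * (-((k - 1) / (n * l))) := by
    rw [aC, bC]
    linarith
  rw [mC, h3, Int.mul_ediv_cancel_left _ (mul_pos hn hl).ne']

/-- An integer is determined by `b` together with `a - n m`. -/
theorem eq_of_bC_eq_of_aC_sub_eq {n l : ℤ} (hn : 0 < n) (hl : 0 < l) {k k' : ℤ}
    (hb : bC n l k = bC n l k')
    (hx : aC n k - n * mC n l k = aC n k' - n * mC n l k') : k = k' := by
  rw [mC_eq hn hl, mC_eq hn hl] at hx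
  have h1 := emod_add_mul_emod_mul_ediv n l (k - 1)
  have h1' := emod_add_mul_emod_mul_ediv n l (k' - 1)
  have h2 := Int.emod_add_mul_ediv (k - 1) (n * l)
  have h2' := Int.emod_add_mul_ediv (k' - 1) (n * l)
  have ha : (k - 1) % n = (k' - 1) % n := by
    have e : ∀ K q : ℤ, K % n + 1 - n * -q - 1 = K % n + n * q := fun K q => by ring
    have h4 : (k - 1) % n + n * ((k - 1) / (n * l)) =
        (k' - 1) % n + n * ((k' - 1) / (n * l)) := by
      rw [← e, ← e]
      simp only [aC] at hx
      rw [hx]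
    have h5 := congrArg (· % n) h4
    simpa only [Int.add_mul_emod_self_left, Int.emod_emod_of_dvd _ (dvd_refl n)] using h5
  have hq : (k - 1) / (n * l) = (k' - 1) / (n * l) := by
    simp only [aC, ha] at hx
    exact mul_left_cancel₀ hn.ne' (by linarith)
  have hb' : (k - 1) % (n * l) / n = (k' - 1) % (n * l) / n := by
    simpa only [bC, add_left_inj] using hb
  rw [← h1, ha, hb', hq] at h2
  rw [← h1'] at h2'
  linarith

theorem lt_aC_sub_iff {n l : ℤ} (hn : 0 < n) (hl : 0 < l) (k q : ℤ) :
    n * q < aC n k - n * mC n l k ↔ n * l * q < k := by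
  rw [mC_eq hn hl, aC]
  have h0 := Int.emod_nonneg (k - 1) hn.ne'
  have h1 := Int.emod_lt_of_pos (k - 1) hn
  have h2 : n * l * q < k ↔ q ≤ (k - 1) / (n * l) := by
    rw [Int.le_ediv_iff_mul_le (mul_pos hn hl), mul_comm q]
    omega
  rw [h2]
  constructor
  · intro h
    by_contra! hc
    nlinarith
  · intro h
    nlinarith

/-- In the bead sequence `μ_i + c - i`, the beads above a sufficiently low level `U` are exactly
the first `c - U` ones. -/
theorem lt_bead_iff (μ : Ptn) (c U : ℤ) {N : ℕ} (hN : ∀ i ≥ N, μ.1 i = 0)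
    (hU : U ≤ c - N) (i : ℕ) :
    U < (μ.1 i : ℤ) + c - i ↔ i < (c - U).toNat := by
  rcases le_or_gt N i with h | h
  · rw [hN i h]
    omega
  · omega

theorem bead_injective (μ : Ptn) (c : ℤ) :
    Function.Injective (fun i : ℕ => (μ.1 i : ℤ) + c - i) := by
  have : StrictAnti (fun i : ℕ => (μ.1 i : ℤ) + c - i) := by
    intro i j hij
    have := μ.2.1 hij.le
    simp only
    omega
  exact this.injective

/-- The number of beads above the level `n l q` with `b`-coordinate `b` only depends on the
charge `s_b`, as soon as the level is low enough. -/
theorem IotaLSpec.exists_card_filter_eq {n l : ℕ} (hn : 0 < n) (hl : 0 < l) {lam : Ptn} {s : ℤ}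
    {lamT : Fin l → Ptn} {sT : Fin l → ℤ} (h : IotaLSpec n l lam s lamT sT) :
    ∃ Q : ℤ, ∀ q ≤ Q, n * l * q ≤ s ∧ (∀ i ≥ (s - n * l * q).toNat, lam.1 i = 0) ∧
      ∀ b : Fin l, ((Finset.range (s - n * l * q).toNat).filter (fun i =>
        bC n l ((lam.1 i : ℤ) + s - i) = (b : ℤ) + 1)).card = (sT b - n * q).toNat := by
  have hn' : (0 : ℤ) < n := by exact_mod_cast hn
  have hl' : (0 : ℤ) < l := by exact_mod_cast hl
  obtain ⟨N, hN⟩ := lam.2.2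
  choose NT hNT using fun b => (lamT b).2.2
  obtain ⟨B, hB⟩ : ∃ B : ℤ, ∀ b, B ≤ sT b - NT b := by
    have : Nonempty (Fin l) := ⟨⟨0, hl⟩⟩
    obtain ⟨b, hb⟩ := Finite.exists_min (fun b => sT b - (NT b : ℤ))
    exact ⟨_, hb⟩
  refine ⟨min 0 (min (s - N) B), fun q hq => ?_⟩
  have hq0 : q ≤ 0 := hq.trans (min_le_left _ _)
  have hqs : q ≤ s - N := hq.trans ((min_le_right _ _).trans (min_le_left _ _))
  have hqB : q ≤ B := hq.trans ((min_le_right _ _).trans (min_le_right _ _))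
  have hnlq : n * l * q ≤ q := by nlinarith [mul_pos hn' hl']
  have hnq : n * q ≤ q := by nlinarith
  refine ⟨by omega, fun i hi => hN i (by omega), fun b => ?_⟩
  set x : ℕ → ℤ := fun i => aC n ((lam.1 i : ℤ) + s - i) - n * mC n l ((lam.1 i : ℤ) + s - i)
  set y : ℕ → ℤ := fun i => ((lamT b).1 i : ℤ) + sT b - i
  have hy : ∀ i, n * q < y i ↔ i < (sT b - n * q).toNat :=
    lt_bead_iff (lamT b) (sT b) _ (hNT b) (by have := hB b; omega)
  have hx : ∀ i, n * q < x i ↔ i < (s - n * l * q).toNat := fun i =>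
    (lt_aC_sub_iff hn' hl' _ q).trans (lt_bead_iff lam s _ hN (by omega) i)
  have himage : ((Finset.range (s - n * l * q).toNat).filter (fun i =>
      bC n l ((lam.1 i : ℤ) + s - i) = (b : ℤ) + 1)).image x =
      (Finset.range (sT b - n * q).toNat).image y := by
    ext z
    have hz := Set.ext_iff.mp (h b) z
    simp only [Set.mem_range, Set.mem_ofPred_eq] at hz
    simp only [Finset.mem_image, Finset.mem_filter, Finset.mem_range, ← hx, ← hy]
    constructor
    · rintro ⟨i, ⟨hi, hbi⟩, rfl⟩
      obtain ⟨j, hj⟩ := hz.mpr ⟨i, hbi, rfl⟩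
      exact ⟨j, hi.trans_eq hj.symm, hj⟩
    · rintro ⟨j, hj, rfl⟩
      obtain ⟨i, hbi, hi⟩ := hz.mp ⟨j, rfl⟩
      exact ⟨i, ⟨hj.trans_eq hi, hbi⟩, hi.symm⟩
  have hcard := congrArg Finset.card himage
  rwa [Finset.card_image_of_injective _ (bead_injective (lamT b) (sT b)), Finset.card_range,
    Finset.card_image_of_injOn] at hcard
  intro i hi j hj hij
  simp only [Finset.coe_filter, Set.mem_ofPred_eq] at hi hj
  exact bead_injective lam s (eq_of_bC_eq_of_aC_sub_eq hn' hl' (hi.2.trans hj.2.symm) hij)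

theorem card_filter_eq_of_fiberwise {α β γ : Type*} [DecidableEq γ] {S : Finset α} {S' : Finset β}
    {f : α → γ} {g : β → γ} {t : Finset γ} (hf : ∀ i, f i ∈ t) (hg : ∀ i, g i ∈ t)
    (h : ∀ c ∈ t, (S.filter (f · = c)).card = (S'.filter (g · = c)).card)
    (p : γ → Prop) [DecidablePred p] :
    (S.filter (fun i => p (f i))).card = (S'.filter (fun i => p (g i))).card := by
  rw [Finset.card_eq_sum_card_fiberwise (f := f) (t := t) fun i _ => hf i,
    Finset.card_eq_sum_card_fiberwise (f := g) (t := t) fun i _ => hg i]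
  refine Finset.sum_congr rfl fun c hc => ?_
  rw [Finset.filter_filter, Finset.filter_filter]
  by_cases hp : p c
  · have e : ∀ x : γ, (p x ∧ x = c) ↔ x = c := fun x => and_iff_right_of_imp fun hx => hx ▸ hp
    simpa only [e] using h c hc
  · have e : ∀ x : γ, (p x ∧ x = c) ↔ False := fun x =>
      iff_of_false (fun hx => hp (hx.2 ▸ hx.1)) id
    simp only [e, Finset.filter_false, Finset.card_empty]

theorem stmt_3 (n l : ℕ) (hn : 1 < n) (hl : 1 < l)
    (lamT : Fin l → Ptn) (sT : Fin l → ℤ)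
    (lam lam0 : Ptn) (s s0 : ℤ)
    (hspec : IotaLSpec n l lam s lamT sT)
    (hspec0 : IotaLSpec n l lam0 s0 (fun _ => emptyPtn) sT) :
    ∀ Φ : ℕ → ℤ,
      (∀ j : ℕ, Φ j =
        (((Finset.range j).filter (fun i =>
            bC n l ((lam.1 i : ℤ) + s - i) < bC n l ((lam.1 j : ℤ) + s - j))).card : ℤ)
        - (((Finset.range j).filter (fun i =>
            bC n l ((lam0.1 i : ℤ) + s0 - i)
              < bC n l ((lam0.1 j : ℤ) + s0 - j))).card : ℤ)) →
      ∃ N : ℕ, (∀ j ≥ N, Φ j = 0) ∧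
        ∀ M ≥ N, ∑ j ∈ Finset.range M, Φ j = ∑ j ∈ Finset.range N, Φ j := by
  intro Φ hΦ
  have hn0 : 0 < n := by omega
  have hl0 : 0 < l := by omega
  obtain ⟨Q, hQ⟩ := hspec.exists_card_filter_eq hn0 hl0
  obtain ⟨Q0, hQ0⟩ := hspec0.exists_card_filter_eq hn0 hl0
  obtain ⟨hs, hz, hc⟩ := hQ _ (min_le_left Q Q0)
  obtain ⟨hs0, hz0, hc0⟩ := hQ0 _ (min_le_right Q Q0)
  set J := (s - n * l * min Q Q0).toNat
  set J0 := (s0 - n * l * min Q Q0).toNat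
  have key := card_filter_eq_of_fiberwise (S := Finset.range J) (S' := Finset.range J0)
    (f := fun i => bC n l ((lam.1 i : ℤ) + s - i))
    (g := fun i => bC n l ((lam0.1 i : ℤ) + s0 - i))
    (fun i => bC_mem_Icc hn0 hl0 _) (fun i => bC_mem_Icc hn0 hl0 _) (by
      intro c hcl
      rw [Finset.mem_Icc] at hcl
      have hcb := hc ⟨(c - 1).toNat, by omega⟩
      have hcb0 := hc0 ⟨(c - 1).toNat, by omega⟩
      have e : (((c - 1).toNat : ℕ) : ℤ) + 1 = c := by omega
      simp only [e] at hcb hcb0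
      exact hcb.trans hcb0.symm)
  have hJ : J = J0 := by simpa using key fun _ => True
  obtain rfl : s = s0 := by omega
  have hΦ0 : ∀ j ≥ J, Φ j = 0 := by
    intro j hj
    rw [hΦ, hz j hj, hz0 j hj, sub_eq_zero, Nat.cast_inj, Finset.range_eq_Ico,
      ← Finset.Ico_union_Ico_eq_Ico (Nat.zero_le J) hj, ← Finset.range_eq_Ico,
      Finset.filter_union, Finset.filter_union, Finset.card_union_of_disjoint,
      Finset.card_union_of_disjoint]
    · congr 1
      · exact key (· < bC n l (((0 : ℕ) : ℤ) + s - j))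
      · congr 1
        refine Finset.filter_congr fun i hi => ?_
        rw [Finset.mem_Ico] at hi
        rw [hz i hi.1, hz0 i hi.1]
    all_goals
      refine Finset.disjoint_filter_filter ?_
      rw [Finset.range_eq_Ico]
      exact Finset.Ico_disjoint_Ico_consecutive 0 J j
  refine ⟨J, hΦ0, fun M hM => ?_⟩
  refine (Finset.sum_subset (Finset.range_mono hM) fun j _ hj => hΦ0 j ?_).symm
  simpa using hj
end

section
/- On the level-l q-deformed Fock space F, for all r, s ∈ ℤ/nℤ the operators satisfy e_r f_s − f_s e_r = δ(r = s) · (t_r − t_r^{−1})/(q − q^{−1}) as ℚ(q)-linear operators on F. -/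
/-!
Shared setup for the level-`l` q-deformed Fock space of `U_q'(sl_n^)` with charge
`sT = (s_1, …, s_l)` (here `sT b` is the paper's `s_{b+1}`; rows and columns of
partitions are 0-indexed, so the node `(i, j, b)` of the paper is `(b, i-1, j-1)`).

* `Ptn` : partitions; `MPtn l` : `l`-multipartitions.
* `addableRow lam b i` : a node can be added to `lam` in component `b`, row `i`;
  the added node then lies in column `(lam b).1 i` and has `d`-value
  `addD sT lam b i = sT b + (lam b).1 i - i` and colour `(addD … : ZMod n)`.
* `removableRow lam b i` : a node can be removed in component `b`, row `i`;
  it has `d`-value `remD sT lam b i = sT b + (lam b).1 i - 1 - i`.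
* `nodeLt` : the total order `(d, b) < (d', b')` on nodes.
* `AddableSet/RemovableSet n l sT lam r` : positions of addable/removable
  `r`-nodes; `Nr` is `N_r(λ)`, and `Ngt/Nlt n l sT lam r γ` are
  `N_r^>(λ,μ)/N_r^<(λ,μ)` for the added node `γ = (d, b)`.
* `AddAt lam mu b i` : `mu` is obtained from `lam` by adding one node in component
  `b`, row `i`; `AddOne n l sT r lam mu` is the relation `μ/λ = r`.
* `Fock l = (MPtn l) →₀ ℚ(q)` with natural basis `phi l lam`; the operators
  `e r, f r, t r, t r ^{-1}` are characterized by their matrix entries in this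
  basis (hypotheses of the theorems below).
-/

noncomputable section

abbrev KK : Type := RatFunc ℚ

/-- the indeterminate `q`. -/
noncomputable def qq : KK := RatFunc.X

abbrev MPtn (l : ℕ) : Type := Fin l → Ptn

def addableRow {l : ℕ} (lam : MPtn l) (b : Fin l) (i : ℕ) : Prop :=
  i = 0 ∨ (lam b).1 i < (lam b).1 (i - 1)

def removableRow {l : ℕ} (lam : MPtn l) (b : Fin l) (i : ℕ) : Prop :=
  (lam b).1 (i + 1) < (lam b).1 i

def addD {l : ℕ} (sT : Fin l → ℤ) (lam : MPtn l) (b : Fin l) (i : ℕ) : ℤ :=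
  sT b + (lam b).1 i - i

def remD {l : ℕ} (sT : Fin l → ℤ) (lam : MPtn l) (b : Fin l) (i : ℕ) : ℤ :=
  sT b + (lam b).1 i - 1 - i

def nodeLt {l : ℕ} (p q : ℤ × Fin l) : Prop :=
  p.1 < q.1 ∨ (p.1 = q.1 ∧ p.2 < q.2)

def AddableSet (n l : ℕ) (sT : Fin l → ℤ) (lam : MPtn l) (r : ZMod n) :
    Set (Fin l × ℕ) :=
  {p | addableRow lam p.1 p.2 ∧ ((addD sT lam p.1 p.2 : ℤ) : ZMod n) = r}

def RemovableSet (n l : ℕ) (sT : Fin l → ℤ) (lam : MPtn l) (r : ZMod n) :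
    Set (Fin l × ℕ) :=
  {p | removableRow lam p.1 p.2 ∧ ((remD sT lam p.1 p.2 : ℤ) : ZMod n) = r}

/-- `N_r(λ)`. -/
def Nr (n l : ℕ) (sT : Fin l → ℤ) (lam : MPtn l) (r : ZMod n) : ℤ :=
  ((AddableSet n l sT lam r).ncard : ℤ) - ((RemovableSet n l sT lam r).ncard : ℤ)

/-- `N_r^>(λ, μ)`, where `γ = (d, b)` is the node added to `λ` to get `μ`. -/
def Ngt (n l : ℕ) (sT : Fin l → ℤ) (lam : MPtn l) (r : ZMod n) (γ : ℤ × Fin l) : ℤ :=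
  (({p : Fin l × ℕ | p ∈ AddableSet n l sT lam r ∧
      nodeLt γ (addD sT lam p.1 p.2, p.1)}).ncard : ℤ)
  - (({p : Fin l × ℕ | p ∈ RemovableSet n l sT lam r ∧
      nodeLt γ (remD sT lam p.1 p.2, p.1)}).ncard : ℤ)

/-- `N_r^<(λ, μ)`, where `γ = (d, b)` is the node added to `λ` to get `μ`. -/
def Nlt (n l : ℕ) (sT : Fin l → ℤ) (lam : MPtn l) (r : ZMod n) (γ : ℤ × Fin l) : ℤ :=
  (({p : Fin l × ℕ | p ∈ AddableSet n l sT lam r ∧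
      nodeLt (addD sT lam p.1 p.2, p.1) γ}).ncard : ℤ)
  - (({p : Fin l × ℕ | p ∈ RemovableSet n l sT lam r ∧
      nodeLt (remD sT lam p.1 p.2, p.1) γ}).ncard : ℤ)

/-- `mu` is obtained from `lam` by adding one node, in component `b`, row `i`. -/
def AddAt {l : ℕ} (lam mu : MPtn l) (b : Fin l) (i : ℕ) : Prop :=
  (mu b).1 i = (lam b).1 i + 1 ∧
  (∀ i' : ℕ, i' ≠ i → (mu b).1 i' = (lam b).1 i') ∧
  (∀ b' : Fin l, b' ≠ b → mu b' = lam b')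

/-- the relation `μ/λ = r`. -/
def AddOne (n l : ℕ) (sT : Fin l → ℤ) (r : ZMod n) (lam mu : MPtn l) : Prop :=
  ∃ (b : Fin l) (i : ℕ), AddAt lam mu b i ∧ ((addD sT lam b i : ℤ) : ZMod n) = r

abbrev Fock (l : ℕ) : Type := MPtn l →₀ KK

/-- the natural basis vector `φ(λ_l, s_l)`. -/
noncomputable def phi (l : ℕ) (lam : MPtn l) : Fock l := Finsupp.single lam 1

namespace FockSpace

variable {l : ℕ}

theorem AddAt.addNode_unique {lam mu mu' : MPtn l} {b : Fin l} {i : ℕ}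
    (h : AddAt lam mu b i) (h' : AddAt lam mu' b i) : mu = mu' := by
  funext b'
  apply Subtype.ext
  funext j
  by_cases hb : b' = b
  · subst hb
    by_cases hj : j = i
    · subst hj; rw [h.1, h'.1]
    · rw [h.2.1 j hj, h'.2.1 j hj]
  · rw [h.2.2 b' hb, h'.2.2 b' hb]

theorem AddAt.subNode_unique {lam lam' mu : MPtn l} {b : Fin l} {i : ℕ}
    (h : AddAt lam mu b i) (h' : AddAt lam' mu b i) : lam = lam' := by
  funext b'
  apply Subtype.ext
  funext j
  by_cases hb : b' = b
  · subst hb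
    by_cases hj : j = i
    · subst hj
      have := h.1
      have := h'.1
      omega
    · rw [← h.2.1 j hj, ← h'.2.1 j hj]
  · rw [← h.2.2 b' hb, ← h'.2.2 b' hb]

theorem AddAt.node_unique {lam mu : MPtn l} {b b' : Fin l} {i i' : ℕ}
    (h : AddAt lam mu b i) (h' : AddAt lam mu b' i') : (b, i) = (b', i') := by
  have hb : b = b' := by
    by_contra hb
    have h1 := h.1
    rw [h'.2.2 b hb] at h1
    omega
  subst hb
  have hi : i = i' := by
    by_contra hi
    have h1 := h.1
    rw [h'.2.1 i hi] at h1
    omega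
  rw [hi]

theorem exists_row_update (lam : MPtn l) (b : Fin l) (i : ℕ) {a : ℕ}
    (h : Antitone (Function.update (lam b).1 i a)) :
    ∃ mu : MPtn l, (mu b).1 = Function.update (lam b).1 i a ∧ ∀ b' ≠ b, mu b' = lam b' := by
  obtain ⟨N, hN⟩ := (lam b).2.2
  have hzero : ∃ M, ∀ j ≥ M, Function.update (lam b).1 i a j = 0 := by
    refine ⟨max N (i + 1), fun j hj => ?_⟩
    rw [Function.update_of_ne (by omega)]
    exact hN j (by omega)
  exact ⟨Function.update lam b ⟨_, h, hzero⟩,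
    congrArg Subtype.val (Function.update_self b _ lam),
    fun b' hb' => Function.update_of_ne hb' _ _⟩

theorem addableRow_iff_exists_addAt {lam : MPtn l} {b : Fin l} {i : ℕ} :
    addableRow lam b i ↔ ∃ mu, AddAt lam mu b i := by
  constructor
  · intro h
    have hanti := (lam b).2.1
    have hupd : Antitone (Function.update (lam b).1 i ((lam b).1 i + 1)) := by
      refine antitone_nat_of_succ_le fun j => ?_
      have hj := hanti (show j ≤ j + 1 by omega)
      rcases eq_or_ne j i with rfl | hji
      · simp only [Function.update_self, Function.update_of_ne (show j + 1 ≠ j by omega)]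
        omega
      · rw [Function.update_of_ne hji]
        rcases eq_or_ne (j + 1) i with rfl | hji'
        · rw [Function.update_self]
          rcases h with h | h
          · omega
          · simpa using h
        · rwa [Function.update_of_ne hji']
    obtain ⟨mu, h1, h2⟩ := exists_row_update lam b i hupd
    exact ⟨mu, by simp [h1], fun j hj => by simp [h1, hj], h2⟩
  · rintro ⟨mu, h⟩
    rcases Nat.eq_zero_or_pos i with hi | hi
    · exact Or.inl hi
    · right
      have h1 := (mu b).2.1 (Nat.sub_le i 1)
      rw [h.1, h.2.1 (i - 1) (by omega)] at h1
      omega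

theorem removableRow_iff_exists_addAt {mu : MPtn l} {b : Fin l} {i : ℕ} :
    removableRow mu b i ↔ ∃ lam, AddAt lam mu b i := by
  constructor
  · intro h
    unfold removableRow at h
    have hanti := (mu b).2.1
    have hupd : Antitone (Function.update (mu b).1 i ((mu b).1 i - 1)) := by
      refine antitone_nat_of_succ_le fun j => ?_
      have hj := hanti (show j ≤ j + 1 by omega)
      rcases eq_or_ne j i with rfl | hji
      · simp only [Function.update_self, Function.update_of_ne (show j + 1 ≠ j by omega)]
        omega
      · rw [Function.update_of_ne hji]
        rcases eq_or_ne (j + 1) i with rfl | hji'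
        · rw [Function.update_self]
          omega
        · rwa [Function.update_of_ne hji']
    obtain ⟨lam, h1, h2⟩ := exists_row_update mu b i hupd
    exact ⟨lam, by rw [h1, Function.update_self]; omega, fun j hj => by simp [h1, hj],
      fun b' hb' => (h2 b' hb').symm⟩
  · rintro ⟨lam, h⟩
    have h1 := (lam b).2.1 (Nat.le_succ i)
    have h2 := h.2.1 (i + 1) (by omega)
    have h3 := h.1
    simp only [Nat.succ_eq_add_one] at h1
    unfold removableRow
    omega

section

variable {lam mu : MPtn l} {b : Fin l} {i : ℕ} (sT : Fin l → ℤ)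

theorem AddAt.apply_of_ne (h : AddAt lam mu b i) {b' : Fin l} {j : ℕ}
    (hne : (b', j) ≠ (b, i)) : (mu b').1 j = (lam b').1 j := by
  by_cases hb : b' = b
  · subst hb
    exact h.2.1 j (by rintro rfl; exact hne rfl)
  · rw [h.2.2 b' hb]

theorem AddAt.addD_of_ne (h : AddAt lam mu b i) {b' : Fin l} {j : ℕ}
    (hne : (b', j) ≠ (b, i)) : addD sT mu b' j = addD sT lam b' j := by
  rw [addD, addD, AddAt.apply_of_ne h hne]

theorem AddAt.remD_eq (h : AddAt lam mu b i) : remD sT mu b i = addD sT lam b i := by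
  rw [remD, addD, h.1]
  push_cast
  ring

end

/-- Adding a node and then removing a different one can be done in the other order. -/
theorem AddAt.exists_lower {lam nu kap : MPtn l} {b b' : Fin l} {i i' : ℕ}
    (h : AddAt lam kap b i) (h' : AddAt nu kap b' i') (hne : (b, i) ≠ (b', i')) :
    ∃ rho, AddAt rho lam b' i' ∧ AddAt rho nu b i := by
  have hrem : removableRow lam b' i' := by
    have h1 := (nu b').2.1 (Nat.le_succ i')
    have h2 := h'.2.1 (i' + 1) (by omega)
    have h3 := h'.1
    have h4 := AddAt.apply_of_ne h hne.symm
    have h5 : (lam b').1 (i' + 1) ≤ (kap b').1 (i' + 1) := by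
      by_cases hc : (b', i' + 1) = (b, i)
      · cases hc; rw [h.1]; omega
      · rw [AddAt.apply_of_ne h hc]
    simp only [Nat.succ_eq_add_one] at h1
    unfold removableRow
    omega
  obtain ⟨rho, hrho⟩ := removableRow_iff_exists_addAt.1 hrem
  refine ⟨rho, hrho, ?_, ?_, ?_⟩
  · rw [← AddAt.apply_of_ne h' hne, h.1, AddAt.apply_of_ne hrho hne]
  · intro j hj
    have hj' : (b, j) ≠ (b, i) := by simpa using hj
    by_cases hc : (b, j) = (b', i')
    · cases hc
      have := h'.1
      have := hrho.1
      have := AddAt.apply_of_ne h hj'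
      omega
    · rw [← AddAt.apply_of_ne h' hc, AddAt.apply_of_ne h hj', AddAt.apply_of_ne hrho hc]
  · intro c hc
    apply Subtype.ext
    funext j
    have hj' : (c, j) ≠ (b, i) := by simp [hc]
    by_cases hc : (c, j) = (b', i')
    · cases hc
      have := h'.1
      have := hrho.1
      have := AddAt.apply_of_ne h hj'
      omega
    · rw [← AddAt.apply_of_ne h' hc, AddAt.apply_of_ne h hj', AddAt.apply_of_ne hrho hc]

/-- Removing a node and then adding a different one can be done in the other order. -/
theorem AddAt.exists_upper {lam nu rho : MPtn l} {b b' : Fin l} {i i' : ℕ}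
    (h' : AddAt rho lam b' i') (h : AddAt rho nu b i) (hne : (b, i) ≠ (b', i')) :
    ∃ kap, AddAt lam kap b i ∧ AddAt nu kap b' i' := by
  have hadd : addableRow lam b i := by
    rcases addableRow_iff_exists_addAt.2 ⟨nu, h⟩ with h1 | h1
    · exact Or.inl h1
    · right
      have h2 : (rho b).1 (i - 1) ≤ (lam b).1 (i - 1) := by
        by_cases hc : (b, i - 1) = (b', i')
        · cases hc; rw [h'.1]; omega
        · rw [AddAt.apply_of_ne h' hc]
      have h3 := AddAt.apply_of_ne h' hne
      omega
  obtain ⟨kap, hkap⟩ := addableRow_iff_exists_addAt.1 hadd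
  refine ⟨kap, hkap, ?_, ?_, ?_⟩
  · rw [AddAt.apply_of_ne hkap hne.symm, h'.1, AddAt.apply_of_ne h hne.symm]
  · intro j hj
    have hj' : (b', j) ≠ (b', i') := by simpa using hj
    by_cases hc : (b', j) = (b, i)
    · cases hc
      have := h.1
      have := hkap.1
      have := AddAt.apply_of_ne h' hj'
      omega
    · rw [AddAt.apply_of_ne hkap hc, AddAt.apply_of_ne h' hj', AddAt.apply_of_ne h hc]
  · intro c hc
    apply Subtype.ext
    funext j
    have hj' : (c, j) ≠ (b', i') := by simp [hc]
    by_cases hc : (c, j) = (b, i)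
    · cases hc
      have := h.1
      have := hkap.1
      have := AddAt.apply_of_ne h' hj'
      omega
    · rw [AddAt.apply_of_ne hkap hc, AddAt.apply_of_ne h' hj', AddAt.apply_of_ne h hc]

section Contents

variable (sT : Fin l → ℤ) (lam : MPtn l)

theorem strictAnti_addD (b : Fin l) : StrictAnti (addD sT lam b) := by
  refine strictAnti_nat_of_succ_lt fun j => ?_
  have hj := (lam b).2.1 (Nat.le_succ j)
  simp only [Nat.succ_eq_add_one] at hj
  simp only [addD]
  push_cast
  omega

theorem remD_eq_addD_sub_one (b : Fin l) (i : ℕ) :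
    remD sT lam b i = addD sT lam b i - 1 := by
  simp only [remD, addD]
  ring

theorem addableRow_iff (b : Fin l) (i : ℕ) :
    addableRow lam b i ↔ addD sT lam b i + 1 ∉ Set.range (addD sT lam b) := by
  have hanti := strictAnti_addD sT lam b
  constructor
  · rintro h ⟨j, hj⟩
    have hji : j < i := by
      by_contra hc
      have := hanti.antitone (not_lt.1 hc)
      omega
    rcases h with h | h
    · omega
    · have h1 := hanti.antitone (show j ≤ i - 1 by omega)
      simp only [addD] at h1 hj
      omega
  · intro h
    by_contra hc
    simp only [addableRow, not_or, not_lt] at hc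
    refine h ⟨i - 1, ?_⟩
    have := (lam b).2.1 (Nat.sub_le i 1)
    simp only [addD]
    omega

theorem removableRow_iff (b : Fin l) (i : ℕ) :
    removableRow lam b i ↔ addD sT lam b i - 1 ∉ Set.range (addD sT lam b) := by
  have hanti := strictAnti_addD sT lam b
  constructor
  · rintro h ⟨j, hj⟩
    have hji : i < j := by
      by_contra hc
      have := hanti.antitone (not_lt.1 hc)
      omega
    have h1 := hanti.antitone (show i + 1 ≤ j by omega)
    simp only [removableRow] at h
    simp only [addD] at h1 hj
    push_cast at h1
    omega
  · intro h
    by_contra hc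
    simp only [removableRow, not_lt] at hc
    refine h ⟨i + 1, ?_⟩
    have := (lam b).2.1 (Nat.le_succ i)
    simp only [Nat.succ_eq_add_one] at this
    simp only [addD]
    push_cast
    omega

theorem finite_setOf_of_le_bound {P : Fin l → ℕ → Prop}
    (h : ∀ b, ∃ N, ∀ i, P b i → i ≤ N) : {p : Fin l × ℕ | P p.1 p.2}.Finite := by
  choose N hN using h
  refine (Set.finite_iUnion fun b => (Set.finite_Iic (N b)).image (Prod.mk b)).subset ?_
  rintro ⟨b, i⟩ hp
  exact Set.mem_iUnion.2 ⟨b, i, hN b i hp, rfl⟩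

theorem finite_addable : {p : Fin l × ℕ | addableRow lam p.1 p.2}.Finite := by
  refine finite_setOf_of_le_bound fun b => ?_
  obtain ⟨N, hN⟩ := (lam b).2.2
  refine ⟨N, fun i hi => ?_⟩
  by_contra hc
  rcases hi with hi | hi
  · omega
  · rw [hN (i - 1) (by omega)] at hi
    omega

theorem finite_removable : {p : Fin l × ℕ | removableRow lam p.1 p.2}.Finite := by
  refine finite_setOf_of_le_bound fun b => ?_
  obtain ⟨N, hN⟩ := (lam b).2.2
  refine ⟨N, fun i hi => ?_⟩
  by_contra hc
  rw [removableRow, hN i (by omega)] at hi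
  omega

/-- The positions of the addable nodes. -/
def addables : Finset (Fin l × ℕ) := (finite_addable lam).toFinset

/-- The positions of the removable nodes. -/
def removables : Finset (Fin l × ℕ) := (finite_removable lam).toFinset

variable {lam} in
theorem mem_addables {p : Fin l × ℕ} : p ∈ addables lam ↔ addableRow lam p.1 p.2 := by
  simp [addables]

variable {lam} in
theorem mem_removables {p : Fin l × ℕ} :
    p ∈ removables lam ↔ removableRow lam p.1 p.2 := by
  simp [removables]

/-- The pair `(d, b)` attached to the node that can be added at `p`. -/
def addKey (p : Fin l × ℕ) : ℤ ×ₗ Fin l := toLex (addD sT lam p.1 p.2, p.1)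

/-- The pair `(d, b)` attached to the node that can be removed at `p`. -/
def remKey (p : Fin l × ℕ) : ℤ ×ₗ Fin l := toLex (remD sT lam p.1 p.2, p.1)

theorem nodeLt_iff {x y : ℤ × Fin l} : nodeLt x y ↔ toLex x < toLex y := by
  rw [Prod.Lex.toLex_lt_toLex]
  rfl

/-- The sum of the addable nodes minus the sum of the removable nodes, as a formal combination of
pairs `(d, b)`. -/
def boundary : ℤ ×ₗ Fin l →₀ ℤ :=
  ∑ p ∈ addables lam, Finsupp.single (addKey sT lam p) 1 -
    ∑ p ∈ removables lam, Finsupp.single (remKey sT lam p) 1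

open Classical in
/-- The indicator function of the set of beta numbers of the component `b`. -/
def betaInd (b : Fin l) (c : ℤ) : ℤ := if c ∈ Set.range (addD sT lam b) then 1 else 0

theorem boundary_apply (c : ℤ) (b : Fin l) :
    boundary sT lam (toLex (c, b)) = betaInd sT lam b c - betaInd sT lam b (c + 1) := by
  classical
  have key : ∀ (b : Fin l) (i : ℕ) (p : Fin l × ℕ),
      addD sT lam p.1 p.2 = addD sT lam b i ∧ p.1 = b ↔ (b, i) = p := by
    rintro b i ⟨b', j⟩
    constructor
    · rintro ⟨h1, rfl⟩
      exact Prod.ext rfl ((strictAnti_addD sT lam b').injective h1.symm)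
    · rintro ⟨⟩
      exact ⟨rfl, rfl⟩
  have hA : (∑ p ∈ addables lam, Finsupp.single (addKey sT lam p) (1 : ℤ)) (toLex (c, b)) =
      if c ∈ Set.range (addD sT lam b) ∧ c + 1 ∉ Set.range (addD sT lam b) then 1 else 0 := by
    simp only [Finsupp.finsetSum_apply, Finsupp.single_apply, addKey, toLex_inj, Prod.mk.injEq]
    by_cases hc : c ∈ Set.range (addD sT lam b)
    · obtain ⟨i, rfl⟩ := hc
      simp only [key, Finset.sum_ite_eq, mem_addables, addableRow_iff sT, Set.mem_range_self,
        true_and]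
    · rw [if_neg (fun h => hc h.1)]
      refine Finset.sum_eq_zero fun p _ => if_neg ?_
      rintro ⟨h1, rfl⟩
      exact hc ⟨_, h1⟩
  have hR : (∑ p ∈ removables lam, Finsupp.single (remKey sT lam p) (1 : ℤ)) (toLex (c, b)) =
      if c + 1 ∈ Set.range (addD sT lam b) ∧ c ∉ Set.range (addD sT lam b) then 1 else 0 := by
    simp only [Finsupp.finsetSum_apply, Finsupp.single_apply, remKey, toLex_inj, Prod.mk.injEq,
      remD_eq_addD_sub_one, sub_eq_iff_eq_add]
    by_cases hc : c + 1 ∈ Set.range (addD sT lam b)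
    · obtain ⟨i, hi⟩ := hc
      obtain rfl : c = addD sT lam b i - 1 := by omega
      simp only [sub_add_cancel, key, Finset.sum_ite_eq, mem_removables, removableRow_iff sT,
        Set.mem_range_self, true_and]
    · rw [if_neg (fun h => hc h.1)]
      refine Finset.sum_eq_zero fun p _ => if_neg ?_
      rintro ⟨h1, rfl⟩
      exact hc ⟨_, h1⟩
  rw [boundary, Finsupp.sub_apply, hA, hR, betaInd, betaInd]
  split_ifs <;> simp_all

variable {lam}

open Classical in
theorem AddAt.betaInd_eq {mu : MPtn l} {b : Fin l} {i : ℕ} (h : AddAt lam mu b i)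
    (b' : Fin l) (c : ℤ) :
    betaInd sT mu b' c = betaInd sT lam b' c
      - (if addD sT lam b i = c ∧ b = b' then 1 else 0)
      + (if addD sT lam b i + 1 = c ∧ b = b' then 1 else 0) := by
  by_cases hb : b = b'
  · subst hb
    have hadd := (addableRow_iff sT lam b i).1 (addableRow_iff_exists_addAt.2 ⟨mu, h⟩)
    have hi : addD sT mu b i = addD sT lam b i + 1 := by
      rw [addD, addD, h.1]
      push_cast
      ring
    have hj : ∀ j ≠ i, addD sT mu b j = addD sT lam b j := fun j hj =>
      AddAt.addD_of_ne sT h (by simpa using hj)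
    have hmem : c ∈ Set.range (addD sT mu b) ↔
        c = addD sT lam b i + 1 ∨ (c ∈ Set.range (addD sT lam b) ∧ c ≠ addD sT lam b i) := by
      constructor
      · rintro ⟨j, rfl⟩
        rcases eq_or_ne j i with rfl | hji
        · exact Or.inl hi
        · right
          rw [hj j hji]
          exact ⟨⟨j, rfl⟩, (strictAnti_addD sT lam b).injective.ne hji⟩
      · rintro (rfl | ⟨⟨j, rfl⟩, hne⟩)
        · exact ⟨i, hi⟩
        · exact ⟨j, hj j (by rintro rfl; exact hne rfl)⟩
    rw [betaInd, betaInd]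
    simp only [hmem, and_true]
    by_cases h1 : addD sT lam b i = c
    · subst h1
      simp
    · by_cases h2 : addD sT lam b i + 1 = c
      · subst h2
        simp [hadd]
      · simp [h1, h2, Ne.symm h1, Ne.symm h2]
  · have : addD sT mu b' = addD sT lam b' := by
      funext j
      rw [addD, addD, h.2.2 b' (Ne.symm hb)]
    simp [betaInd, this, hb]

/-- The change of the boundary when a node with attached pair `x` is added. -/
def boundaryShift (x : ℤ × Fin l) : ℤ ×ₗ Fin l →₀ ℤ :=
  Finsupp.single (toLex (x.1 - 1, x.2)) 1 + Finsupp.single (toLex (x.1 + 1, x.2)) 1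
    - Finsupp.single (toLex x) 2

theorem AddAt.boundary_eq {mu : MPtn l} {b : Fin l} {i : ℕ} (h : AddAt lam mu b i) :
    boundary sT mu = boundary sT lam + boundaryShift (addD sT lam b i, b) := by
  classical
  ext x
  obtain ⟨⟨c, b'⟩, rfl⟩ := toLex.surjective x
  rw [Finsupp.add_apply, boundary_apply, boundary_apply, AddAt.betaInd_eq sT h,
    AddAt.betaInd_eq sT h]
  simp only [boundaryShift, Finsupp.sub_apply, Finsupp.add_apply, Finsupp.single_apply, toLex_inj,
    Prod.mk.injEq]
  by_cases hb : b = b'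
  · simp only [hb, and_true]
    split_ifs <;> omega
  · simp [hb]

end Contents

section QuantumInteger

variable {K α : Type*} [Field K] [LinearOrder α]

/-- The quantum integer of a sum of signs, as an alternating sum over the signs. -/
theorem sum_sign_mul_zpow {q : K} (hq : q ≠ 0) (ε : α → ℤ)
    (hε : ∀ x, ε x = -1 ∨ ε x = 0 ∨ ε x = 1) (T : Finset α) :
    (q - q⁻¹) * ∑ x ∈ T, (ε x : K) * q ^ (∑ y ∈ T with x < y, ε y - ∑ y ∈ T with y < x, ε y) =
      q ^ (∑ x ∈ T, ε x) - q ^ (-∑ x ∈ T, ε x) := by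
  induction T using Finset.induction_on_max with
  | empty => simp
  | insert m T hm ih =>
    have hmT : m ∉ T := fun h => lt_irrefl _ (hm m h)
    have hlow : ∀ x ∈ T, ∑ y ∈ insert m T with x < y, ε y - ∑ y ∈ insert m T with y < x, ε y =
        ε m + (∑ y ∈ T with x < y, ε y - ∑ y ∈ T with y < x, ε y) := fun x hx => by
      rw [Finset.filter_insert, Finset.filter_insert, if_pos (hm x hx), if_neg (hm x hx).not_gt,
        Finset.sum_insert (by simp [hmT])]
      ring
    have htop : ∑ y ∈ insert m T with m < y, ε y - ∑ y ∈ insert m T with y < m, ε y =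
        -∑ y ∈ T, ε y := by
      rw [Finset.filter_insert, Finset.filter_insert, if_neg (lt_irrefl m), if_neg (lt_irrefl m),
        Finset.filter_false_of_mem fun y hy => (hm y hy).not_gt, Finset.filter_true_of_mem hm]
      simp
    have hsign : (q - q⁻¹) * (ε m : K) = q ^ ε m - q ^ (-ε m) := by
      rcases hε m with h | h | h <;> simp [h]
    have hsum : ∑ x ∈ T, (ε x : K) *
        q ^ (∑ y ∈ insert m T with x < y, ε y - ∑ y ∈ insert m T with y < x, ε y) = q ^ ε m *
        ∑ x ∈ T, (ε x : K) * q ^ (∑ y ∈ T with x < y, ε y - ∑ y ∈ T with y < x, ε y) := by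
      rw [Finset.mul_sum]
      refine Finset.sum_congr rfl fun x hx => ?_
      rw [hlow x hx, zpow_add₀ hq, mul_left_comm]
    rw [Finset.sum_insert hmT, Finset.sum_insert hmT, htop, hsum, mul_add, ← mul_assoc, hsign,
      mul_left_comm, ih, neg_add, zpow_add₀ hq, zpow_add₀ hq]
    ring

end QuantumInteger

section Weights

variable (n : ℕ) (r : ZMod n)

/-- The color of a node with attached pair `x`. -/
def color (x : ℤ ×ₗ Fin l) : ZMod n := ((ofLex x).1 : ZMod n)

/-- The total coefficient at pairs of color `r` greater than `x`. -/
def weightAbove (x : ℤ ×ₗ Fin l) : (ℤ ×ₗ Fin l →₀ ℤ) →ₗ[ℤ] ℤ :=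
  Finsupp.linearCombination ℤ fun y => if color n y = r ∧ x < y then 1 else 0

/-- The total coefficient at pairs of color `r` less than `x`. -/
def weightBelow (x : ℤ ×ₗ Fin l) : (ℤ ×ₗ Fin l →₀ ℤ) →ₗ[ℤ] ℤ :=
  Finsupp.linearCombination ℤ fun y => if color n y = r ∧ y < x then 1 else 0

/-- The total coefficient at pairs of color `r`. -/
def weight : (ℤ ×ₗ Fin l →₀ ℤ) →ₗ[ℤ] ℤ :=
  Finsupp.linearCombination ℤ fun y => if color n y = r then 1 else 0

variable (sT : Fin l → ℤ) (lam : MPtn l)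

theorem linearCombination_boundary {M : Type*} [AddCommGroup M] (v : ℤ ×ₗ Fin l → M) :
    Finsupp.linearCombination ℤ v (boundary sT lam) =
      ∑ p ∈ addables lam, v (addKey sT lam p) - ∑ p ∈ removables lam, v (remKey sT lam p) := by
  simp [boundary, map_sub, map_sum, Finsupp.linearCombination_single]

theorem ncard_sub_ncard (P : ℤ ×ₗ Fin l → Prop) [DecidablePred P] :
    ({p : Fin l × ℕ | addableRow lam p.1 p.2 ∧ P (addKey sT lam p)}.ncard : ℤ) -
        ({p : Fin l × ℕ | removableRow lam p.1 p.2 ∧ P (remKey sT lam p)}.ncard : ℤ) =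
      Finsupp.linearCombination ℤ (fun y => if P y then (1 : ℤ) else 0) (boundary sT lam) := by
  have hA : {p : Fin l × ℕ | addableRow lam p.1 p.2 ∧ P (addKey sT lam p)} =
      ↑((addables lam).filter fun p => P (addKey sT lam p)) := by
    ext p
    simp [mem_addables]
  have hR : {p : Fin l × ℕ | removableRow lam p.1 p.2 ∧ P (remKey sT lam p)} =
      ↑((removables lam).filter fun p => P (remKey sT lam p)) := by
    ext p
    simp [mem_removables]
  rw [hA, hR, Set.ncard_coe_finset, Set.ncard_coe_finset, linearCombination_boundary,
    Finset.sum_boole, Finset.sum_boole]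

theorem Nr_eq : Nr n l sT lam r = weight n r (boundary sT lam) :=
  ncard_sub_ncard sT lam fun y => color n y = r

theorem Ngt_eq (x : ℤ × Fin l) :
    Ngt n l sT lam r x = weightAbove n r (toLex x) (boundary sT lam) := by
  refine Eq.trans ?_ (ncard_sub_ncard sT lam fun y => color n y = r ∧ toLex x < y)
  simp only [Ngt, nodeLt_iff, AddableSet, RemovableSet, Set.mem_ofPred_eq, and_assoc]
  rfl

theorem Nlt_eq (x : ℤ × Fin l) :
    Nlt n l sT lam r x = weightBelow n r (toLex x) (boundary sT lam) := by
  refine Eq.trans ?_ (ncard_sub_ncard sT lam fun y => color n y = r ∧ y < toLex x)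
  simp only [Nlt, nodeLt_iff, AddableSet, RemovableSet, Set.mem_ofPred_eq, and_assoc]
  rfl

variable {n r}

theorem weightAbove_boundaryShift_self (hn : 2 ≤ n) (x : ℤ × Fin l) :
    weightAbove n (color n (toLex x)) (toLex x) (boundaryShift x) = 0 := by
  have : Fact (1 < n) := ⟨hn⟩
  simp [weightAbove, boundaryShift, color]

theorem weightBelow_boundaryShift_self (hn : 2 ≤ n) (x : ℤ × Fin l) :
    weightBelow n (color n (toLex x)) (toLex x) (boundaryShift x) = 0 := by
  have : Fact (1 < n) := ⟨hn⟩
  simp [weightBelow, boundaryShift, color]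

variable (n) in
theorem weightAbove_boundaryShift (x y : ℤ × Fin l) :
    weightAbove n (color n (toLex x)) (toLex x) (boundaryShift y) =
      weightBelow n (color n (toLex y)) (toLex y) (boundaryShift x) := by
  obtain ⟨c, b⟩ := x
  obtain ⟨d, b'⟩ := y
  have h1 : ((d : ZMod n) - 1 = c ∧ (c < d - 1 ∨ c = d - 1 ∧ b < b')) ↔
      ((c : ZMod n) + 1 = d ∧ (c + 1 < d ∨ c + 1 = d ∧ b < b')) :=
    and_congr ⟨fun h => by rw [← h]; ring, fun h => by rw [← h]; ring⟩ (by omega)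
  have h2 : ((d : ZMod n) + 1 = c ∧ (c < d + 1 ∨ c = d + 1 ∧ b < b')) ↔
      ((c : ZMod n) - 1 = d ∧ (c - 1 < d ∨ c - 1 = d ∧ b < b')) :=
    and_congr ⟨fun h => by rw [← h]; ring, fun h => by rw [← h]; ring⟩ (by omega)
  have h3 : ((d : ZMod n) = c) ↔ ((c : ZMod n) = d) := eq_comm
  simp only [weightAbove, weightBelow, boundaryShift, color, map_sub, map_add,
    Finsupp.linearCombination_single, ofLex_toLex, Int.cast_sub, Int.cast_add, Int.cast_one,
    Prod.Lex.toLex_lt_toLex, h1, h2, h3]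
  ring

variable {lam}

theorem AddAt.remKey_eq {mu : MPtn l} {p : Fin l × ℕ} (h : AddAt lam mu p.1 p.2) :
    remKey sT mu p = addKey sT lam p := by
  rw [remKey, addKey, AddAt.remD_eq sT h]

theorem AddAt.weightAbove_boundary_eq (hn : 2 ≤ n) {mu : MPtn l} {p : Fin l × ℕ}
    (h : AddAt lam mu p.1 p.2) (hr : color n (addKey sT lam p) = r) :
    weightAbove n r (addKey sT lam p) (boundary sT mu) =
      weightAbove n r (addKey sT lam p) (boundary sT lam) := by
  rw [AddAt.boundary_eq sT h, map_add, ← hr, addKey, weightAbove_boundaryShift_self hn, add_zero]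

theorem AddAt.weightBelow_boundary_eq (hn : 2 ≤ n) {mu : MPtn l} {p : Fin l × ℕ}
    (h : AddAt lam mu p.1 p.2) (hr : color n (addKey sT lam p) = r) :
    weightBelow n r (addKey sT lam p) (boundary sT mu) =
      weightBelow n r (addKey sT lam p) (boundary sT lam) := by
  rw [AddAt.boundary_eq sT h, map_add, ← hr, addKey, weightBelow_boundaryShift_self hn, add_zero]

theorem boundary_apply_sign (x : ℤ ×ₗ Fin l) :
    boundary sT lam x = -1 ∨ boundary sT lam x = 0 ∨ boundary sT lam x = 1 := by
  obtain ⟨⟨c, b⟩, rfl⟩ := toLex.surjective x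
  rw [boundary_apply, betaInd, betaInd]
  split_ifs <;> simp

theorem qq_ne_zero : qq ≠ 0 := RatFunc.X_ne_zero

theorem qq_sub_inv_ne_zero : qq - qq⁻¹ ≠ 0 := by
  intro h
  have h1 : qq ^ 2 = 1 := by
    rw [sub_eq_zero] at h
    rw [sq]
    nth_rewrite 2 [h]
    exact mul_inv_cancel₀ qq_ne_zero
  have h2 : (Polynomial.X ^ 2 : Polynomial ℚ) = 1 := by
    apply RatFunc.algebraMap_injective ℚ
    simpa [qq] using h1
  simpa using congrArg Polynomial.natDegree h2

/-- The sum over addable nodes minus the sum over removable nodes of the products of matrix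
coefficients is a quantum integer. -/
theorem linearCombination_boundary_zpow (lam : MPtn l) (r : ZMod n) :
    Finsupp.linearCombination ℤ
        (fun x => if color n x = r then
          qq ^ (weightAbove n r x (boundary sT lam) - weightBelow n r x (boundary sT lam)) else 0)
        (boundary sT lam) =
      (qq - qq⁻¹)⁻¹ * (qq ^ weight n r (boundary sT lam) - qq ^ (-weight n r (boundary sT lam))) := by
  rw [eq_inv_mul_iff_mul_eq₀ qq_sub_inv_ne_zero]
  have key := sum_sign_mul_zpow qq_ne_zero (boundary sT lam) (boundary_apply_sign sT)
    ((boundary sT lam).support.filter fun x => color n x = r)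
  simpa [weight, weightAbove, weightBelow, Finsupp.linearCombination_apply, Finsupp.sum,
    Finset.sum_filter, ite_and] using key

end Weights

section Operators

variable {n : ℕ} (sT : Fin l → ℤ)

open Classical in
/-- The multipartition obtained by adding a node at `p` (and `lam` itself if there is none). -/
def addNode (lam : MPtn l) (p : Fin l × ℕ) : MPtn l :=
  if h : ∃ mu, AddAt lam mu p.1 p.2 then h.choose else lam

open Classical in
/-- The multipartition obtained by removing a node at `p` (and `mu` itself if there is none). -/
def subNode (mu : MPtn l) (p : Fin l × ℕ) : MPtn l :=
  if h : ∃ lam, AddAt lam mu p.1 p.2 then h.choose else mu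

theorem AddAt.addNode_eq {lam mu : MPtn l} {p : Fin l × ℕ} (h : AddAt lam mu p.1 p.2) :
    addNode lam p = mu := by
  have hex : ∃ mu, AddAt lam mu p.1 p.2 := ⟨mu, h⟩
  rw [addNode, dif_pos hex]
  exact AddAt.addNode_unique hex.choose_spec h

theorem AddAt.subNode_eq {lam mu : MPtn l} {p : Fin l × ℕ} (h : AddAt lam mu p.1 p.2) :
    subNode mu p = lam := by
  have hex : ∃ lam, AddAt lam mu p.1 p.2 := ⟨lam, h⟩
  rw [subNode, dif_pos hex]
  exact AddAt.subNode_unique hex.choose_spec h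

theorem addAt_addNode {lam : MPtn l} {p : Fin l × ℕ} (h : addableRow lam p.1 p.2) :
    AddAt lam (addNode lam p) p.1 p.2 := by
  obtain ⟨mu, hmu⟩ := addableRow_iff_exists_addAt.1 h
  rwa [AddAt.addNode_eq hmu]

theorem addAt_subNode {mu : MPtn l} {p : Fin l × ℕ} (h : removableRow mu p.1 p.2) :
    AddAt (subNode mu p) mu p.1 p.2 := by
  obtain ⟨lam, hlam⟩ := removableRow_iff_exists_addAt.1 h
  rwa [AddAt.subNode_eq hlam]

/-- The positions of the addable nodes of color `r`. -/
def colorAddables (lam : MPtn l) (r : ZMod n) : Finset (Fin l × ℕ) :=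
  (addables lam).filter fun p => color n (addKey sT lam p) = r

/-- The positions of the removable nodes of color `r`. -/
def colorRemovables (mu : MPtn l) (r : ZMod n) : Finset (Fin l × ℕ) :=
  (removables mu).filter fun p => color n (remKey sT mu p) = r

variable {sT}

theorem mem_colorAddables {lam : MPtn l} {r : ZMod n} {p : Fin l × ℕ} :
    p ∈ colorAddables sT lam r ↔
      AddAt lam (addNode lam p) p.1 p.2 ∧ color n (addKey sT lam p) = r := by
  rw [colorAddables, Finset.mem_filter, mem_addables]
  exact and_congr_left fun _ =>
    ⟨addAt_addNode, fun h => addableRow_iff_exists_addAt.2 ⟨_, h⟩⟩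

theorem mem_colorRemovables {mu : MPtn l} {r : ZMod n} {p : Fin l × ℕ} :
    p ∈ colorRemovables sT mu r ↔
      AddAt (subNode mu p) mu p.1 p.2 ∧ color n (remKey sT mu p) = r := by
  rw [colorRemovables, Finset.mem_filter, mem_removables]
  exact and_congr_left fun _ =>
    ⟨addAt_subNode, fun h => removableRow_iff_exists_addAt.2 ⟨_, h⟩⟩

theorem apply_phi_eq_sum_addNode {f : ZMod n → Module.End KK (Fock l)}
    (hf : ∀ (lam mu : MPtn l) (b : Fin l) (i : ℕ), AddAt lam mu b i →
      f ((addD sT lam b i : ℤ) : ZMod n) (phi l lam) mu =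
        qq ^ Ngt n l sT lam ((addD sT lam b i : ℤ) : ZMod n) (addD sT lam b i, b))
    (hf0 : ∀ (r : ZMod n) (lam mu : MPtn l), ¬ AddOne n l sT r lam mu →
      f r (phi l lam) mu = 0) (r : ZMod n) (lam : MPtn l) :
    f r (phi l lam) = ∑ p ∈ colorAddables sT lam r,
      qq ^ weightAbove n r (addKey sT lam p) (boundary sT lam) • phi l (addNode lam p) := by
  classical
  ext mu
  simp only [Finsupp.finsetSum_apply, Finsupp.smul_apply, phi, Finsupp.single_apply, smul_eq_mul,
    mul_ite, mul_one, mul_zero]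
  by_cases h : AddOne n l sT r lam mu
  · obtain ⟨b, i, h, rfl⟩ := h
    have hadd : addNode lam (b, i) = mu := AddAt.addNode_eq h
    rw [Finset.sum_eq_single (b, i), if_pos hadd]
    · exact (hf lam mu b i h).trans (by rw [Ngt_eq]; rfl)
    · intro p hp hne
      refine if_neg fun hpm => hne ?_
      have := (mem_colorAddables.1 hp).1
      rw [hpm] at this
      exact AddAt.node_unique this h
    · intro hp
      exact absurd (mem_colorAddables.2 ⟨by rwa [hadd], rfl⟩) hp
  · refine (hf0 r lam mu h).trans (Finset.sum_eq_zero fun p hp => if_neg ?_).symm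
    rintro rfl
    obtain ⟨h1, h2⟩ := mem_colorAddables.1 hp
    exact h ⟨p.1, p.2, h1, h2⟩

theorem apply_phi_eq_sum_subNode (hn : 2 ≤ n) {e : ZMod n → Module.End KK (Fock l)}
    (he : ∀ (lam mu : MPtn l) (b : Fin l) (i : ℕ), AddAt lam mu b i →
      e ((addD sT lam b i : ℤ) : ZMod n) (phi l mu) lam =
        qq ^ (- Nlt n l sT lam ((addD sT lam b i : ℤ) : ZMod n) (addD sT lam b i, b)))
    (he0 : ∀ (r : ZMod n) (lam mu : MPtn l), ¬ AddOne n l sT r lam mu →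
      e r (phi l mu) lam = 0) (r : ZMod n) (mu : MPtn l) :
    e r (phi l mu) = ∑ p ∈ colorRemovables sT mu r,
      qq ^ (-weightBelow n r (remKey sT mu p) (boundary sT mu)) • phi l (subNode mu p) := by
  classical
  ext lam
  simp only [Finsupp.finsetSum_apply, Finsupp.smul_apply, phi, Finsupp.single_apply, smul_eq_mul,
    mul_ite, mul_one, mul_zero]
  by_cases h : AddOne n l sT r lam mu
  · obtain ⟨b, i, h, rfl⟩ := h
    have hsub : subNode mu (b, i) = lam := AddAt.subNode_eq h
    have hkey : remKey sT mu (b, i) = addKey sT lam (b, i) := AddAt.remKey_eq sT h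
    rw [Finset.sum_eq_single (b, i), if_pos hsub]
    · refine (he lam mu b i h).trans ?_
      rw [Nlt_eq, hkey]
      exact congrArg (fun k => qq ^ (-k))
        (AddAt.weightBelow_boundary_eq sT hn (p := (b, i)) h rfl).symm
    · intro p hp hne
      refine if_neg fun hpm => hne ?_
      have := (mem_colorRemovables.1 hp).1
      rw [hpm] at this
      exact AddAt.node_unique this h
    · intro hp
      exact absurd (mem_colorRemovables.2 ⟨by rwa [hsub], by rw [hkey]; rfl⟩) hp
  · refine (he0 r lam mu h).trans (Finset.sum_eq_zero fun p hp => if_neg ?_).symm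
    rintro rfl
    obtain ⟨h1, h2⟩ := mem_colorRemovables.1 hp
    exact h ⟨p.1, p.2, h1, by rw [← h2, AddAt.remKey_eq sT h1]; rfl⟩

/-- Adding a node of color `s` at `p` and then removing one of color `r` at another position `p'`
amounts to the same in the other order. -/
theorem add_then_sub_iff {lam : MPtn l} {r s : ZMod n} {p p' : Fin l × ℕ} (hne : p ≠ p') :
    p ∈ colorAddables sT lam s ∧ p' ∈ colorRemovables sT (addNode lam p) r ↔
      p' ∈ colorRemovables sT lam r ∧ p ∈ colorAddables sT (subNode lam p') s := by
  constructor
  · rintro ⟨h, h'⟩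
    obtain ⟨h, hs⟩ := mem_colorAddables.1 h
    obtain ⟨h', hr⟩ := mem_colorRemovables.1 h'
    obtain ⟨rho, h1, h2⟩ := AddAt.exists_lower h h' hne
    have hsub : subNode lam p' = rho := AddAt.subNode_eq h1
    rw [mem_colorRemovables, mem_colorAddables, hsub, AddAt.addNode_eq h2]
    refine ⟨⟨h1, ?_⟩, h2, ?_⟩
    · rw [← hr]
      simp only [remKey, remD_eq_addD_sub_one, AddAt.addD_of_ne sT h hne.symm]
    · rw [← hs]
      simp only [addKey, AddAt.addD_of_ne sT h1 hne]
  · rintro ⟨h', h⟩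
    obtain ⟨h', hr⟩ := mem_colorRemovables.1 h'
    obtain ⟨h, hs⟩ := mem_colorAddables.1 h
    obtain ⟨kap, h1, h2⟩ := AddAt.exists_upper h' h hne
    have hadd : addNode lam p = kap := AddAt.addNode_eq h1
    rw [mem_colorRemovables, mem_colorAddables, hadd, AddAt.subNode_eq h2]
    refine ⟨⟨h1, ?_⟩, h2, ?_⟩
    · rw [← hs]
      simp only [addKey, AddAt.addD_of_ne sT h' hne]
    · rw [← hr]
      simp only [remKey, remD_eq_addD_sub_one, AddAt.addD_of_ne sT h1 hne.symm]

theorem addNode_subNode_comm {lam : MPtn l} {r s : ZMod n} {p p' : Fin l × ℕ} (hne : p ≠ p')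
    (hp : p ∈ colorAddables sT lam s) (hp' : p' ∈ colorRemovables sT (addNode lam p) r) :
    addNode (subNode lam p') p = subNode (addNode lam p) p' := by
  obtain ⟨rho, h1, h2⟩ :=
    AddAt.exists_lower (mem_colorAddables.1 hp).1 (mem_colorRemovables.1 hp').1 hne
  rw [AddAt.subNode_eq h1, AddAt.addNode_eq h2]

theorem weight_comm {lam : MPtn l} {r s : ZMod n} {p p' : Fin l × ℕ} (hne : p ≠ p')
    (hp : p ∈ colorAddables sT lam s) (hp' : p' ∈ colorRemovables sT (addNode lam p) r) :
    weightAbove n s (addKey sT lam p) (boundary sT lam) -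
        weightBelow n r (remKey sT (addNode lam p) p') (boundary sT (addNode lam p)) =
      weightAbove n s (addKey sT (subNode lam p') p) (boundary sT (subNode lam p')) -
        weightBelow n r (remKey sT lam p') (boundary sT lam) := by
  have hq := (add_then_sub_iff hne).1 ⟨hp, hp'⟩
  obtain ⟨h, hs⟩ := mem_colorAddables.1 hp
  obtain ⟨h', hr⟩ := mem_colorRemovables.1 hq.1
  have h1 : remKey sT (addNode lam p) p' = remKey sT lam p' := by
    simp only [remKey, remD_eq_addD_sub_one, AddAt.addD_of_ne sT h hne.symm]
  have h2 : addKey sT (subNode lam p') p = addKey sT lam p := by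
    simp only [addKey, AddAt.addD_of_ne sT h' hne]
  have h3 := AddAt.boundary_eq sT h
  have h4 := AddAt.boundary_eq sT h'
  have h5 := weightAbove_boundaryShift n (addD sT lam p.1 p.2, p.1)
    (addD sT (subNode lam p') p'.1 p'.2, p'.1)
  have h6 : toLex (addD sT (subNode lam p') p'.1 p'.2, p'.1) = remKey sT lam p' :=
    (AddAt.remKey_eq sT h').symm
  rw [h6, hr] at h5
  change weightAbove n (color n (addKey sT lam p)) (addKey sT lam p) _ = _ at h5
  rw [hs] at h5
  rw [h1, h2, h3, map_add, ← h5]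
  nth_rewrite 1 [h4]
  rw [map_add]
  ring

variable (sT) in
/-- The contribution to `e r (f s φ)` of adding a node at `p` and then removing one at `p'`. -/
def addSubTerm (r s : ZMod n) (lam : MPtn l) (p p' : Fin l × ℕ) : Fock l :=
  qq ^ (weightAbove n s (addKey sT lam p) (boundary sT lam) -
    weightBelow n r (remKey sT (addNode lam p) p') (boundary sT (addNode lam p))) •
    phi l (subNode (addNode lam p) p')

variable (sT) in
/-- The contribution to `f s (e r φ)` of removing a node at `p'` and then adding one at `p`. -/
def subAddTerm (r s : ZMod n) (lam : MPtn l) (p p' : Fin l × ℕ) : Fock l :=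
  qq ^ (weightAbove n s (addKey sT (subNode lam p') p) (boundary sT (subNode lam p')) -
    weightBelow n r (remKey sT lam p') (boundary sT lam)) •
    phi l (addNode (subNode lam p') p)

theorem sum_addSubTerm_erase (r s : ZMod n) (lam : MPtn l) :
    ∑ p ∈ colorAddables sT lam s, ∑ p' ∈ (colorRemovables sT (addNode lam p) r).erase p,
        addSubTerm sT r s lam p p' =
      ∑ p' ∈ colorRemovables sT lam r, ∑ p ∈ (colorAddables sT (subNode lam p') s).erase p',
        subAddTerm sT r s lam p p' := by
  rw [Finset.sum_comm' (t' := colorRemovables sT lam r)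
    (s' := fun p' => (colorAddables sT (subNode lam p') s).erase p')]
  · refine Finset.sum_congr rfl fun p' hp' => Finset.sum_congr rfl fun p hp => ?_
    obtain ⟨hne, hp⟩ := Finset.mem_erase.1 hp
    obtain ⟨h, h'⟩ := (add_then_sub_iff hne).2 ⟨hp', hp⟩
    rw [addSubTerm, subAddTerm, weight_comm hne h h', addNode_subNode_comm hne h h']
  · intro p p'
    rw [Finset.mem_erase, Finset.mem_erase]
    by_cases hne : p = p'
    · simp [hne]
    · have := add_then_sub_iff (sT := sT) (lam := lam) (r := r) (s := s) hne
      have hne' : p' ≠ p := Ne.symm hne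
      tauto

theorem sum_addSubTerm_self (hn : 2 ≤ n) (r s : ZMod n) (lam : MPtn l) :
    ∑ p ∈ colorAddables sT lam s,
        (if p ∈ colorRemovables sT (addNode lam p) r then addSubTerm sT r s lam p p else 0) =
      if r = s then (∑ p ∈ addables lam, if color n (addKey sT lam p) = r then
        qq ^ (weightAbove n r (addKey sT lam p) (boundary sT lam) -
          weightBelow n r (addKey sT lam p) (boundary sT lam)) else 0) • phi l lam else 0 := by
  split_ifs with hrs
  · subst hrs
    rw [← Finset.sum_filter (s := addables lam), Finset.sum_smul]
    refine Finset.sum_congr rfl fun p hp => ?_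
    obtain ⟨h, hr⟩ := mem_colorAddables.1 hp
    have hmem : p ∈ colorRemovables sT (addNode lam p) r :=
      mem_colorRemovables.2 ⟨by rwa [AddAt.subNode_eq h], by rwa [AddAt.remKey_eq sT h]⟩
    rw [if_pos hmem, addSubTerm, AddAt.subNode_eq h, AddAt.remKey_eq sT h,
      AddAt.weightBelow_boundary_eq sT hn h hr]
  · refine Finset.sum_eq_zero fun p hp => if_neg fun hp' => hrs ?_
    obtain ⟨h, hs⟩ := mem_colorAddables.1 hp
    rw [← hs, ← (mem_colorRemovables.1 hp').2, AddAt.remKey_eq sT h]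

theorem sum_subAddTerm_self (hn : 2 ≤ n) (r s : ZMod n) (lam : MPtn l) :
    ∑ p ∈ colorRemovables sT lam r,
        (if p ∈ colorAddables sT (subNode lam p) s then subAddTerm sT r s lam p p else 0) =
      if r = s then (∑ p ∈ removables lam, if color n (remKey sT lam p) = r then
        qq ^ (weightAbove n r (remKey sT lam p) (boundary sT lam) -
          weightBelow n r (remKey sT lam p) (boundary sT lam)) else 0) • phi l lam else 0 := by
  split_ifs with hrs
  · subst hrs
    rw [← Finset.sum_filter (s := removables lam), Finset.sum_smul]
    refine Finset.sum_congr rfl fun p hp => ?_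
    obtain ⟨h, hr⟩ := mem_colorRemovables.1 hp
    rw [AddAt.remKey_eq sT h] at hr
    have hmem : p ∈ colorAddables sT (subNode lam p) r :=
      mem_colorAddables.2 ⟨by rwa [AddAt.addNode_eq h], hr⟩
    rw [if_pos hmem, subAddTerm, AddAt.addNode_eq h, AddAt.remKey_eq sT h,
      AddAt.weightAbove_boundary_eq sT hn h hr]
  · refine Finset.sum_eq_zero fun p hp => if_neg fun hp' => hrs ?_
    obtain ⟨h, hr⟩ := mem_colorRemovables.1 hp
    rw [← hr, ← (mem_colorAddables.1 hp').2, AddAt.remKey_eq sT h]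

theorem sum_eq_ite_add_sum_erase {ι M : Type*} [DecidableEq ι] [AddCommMonoid M] (S : Finset ι)
    (a : ι) (F : ι → M) : ∑ x ∈ S, F x = (if a ∈ S then F a else 0) + ∑ x ∈ S.erase a, F x := by
  split_ifs with h
  · exact (Finset.add_sum_erase S F h).symm
  · rw [Finset.erase_eq_of_notMem h, zero_add]

end Operators

end FockSpace

open FockSpace in
/-- `e_r f_s - f_s e_r = δ_{rs} (t_r - t_r⁻¹)/(q - q⁻¹)` on the Fock
space. -/
theorem stmt_4 (n l : ℕ) (hn : 2 ≤ n) (hl : 1 ≤ l) (sT : Fin l → ℤ)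
    (e f t tinv : ZMod n → Module.End KK (Fock l))
    (hf : ∀ (lam mu : MPtn l) (b : Fin l) (i : ℕ), AddAt lam mu b i →
      f ((addD sT lam b i : ℤ) : ZMod n) (phi l lam) mu =
        qq ^ Ngt n l sT lam ((addD sT lam b i : ℤ) : ZMod n) (addD sT lam b i, b))
    (hf0 : ∀ (r : ZMod n) (lam mu : MPtn l), ¬ AddOne n l sT r lam mu →
      f r (phi l lam) mu = 0)
    (he : ∀ (lam mu : MPtn l) (b : Fin l) (i : ℕ), AddAt lam mu b i →
      e ((addD sT lam b i : ℤ) : ZMod n) (phi l mu) lam =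
        qq ^ (- Nlt n l sT lam ((addD sT lam b i : ℤ) : ZMod n) (addD sT lam b i, b)))
    (he0 : ∀ (r : ZMod n) (lam mu : MPtn l), ¬ AddOne n l sT r lam mu →
      e r (phi l mu) lam = 0)
    (ht : ∀ (r : ZMod n) (lam : MPtn l),
      t r (phi l lam) = qq ^ Nr n l sT lam r • phi l lam)
    (htinv : ∀ (r : ZMod n) (lam : MPtn l),
      tinv r (phi l lam) = qq ^ (- Nr n l sT lam r) • phi l lam) :
    ∀ r s : ZMod n,
      e r * f s - f s * e r =
        if r = s then (qq - qq⁻¹)⁻¹ • (t r - tinv r) else 0 := by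
  classical
  intro r s
  refine Finsupp.lhom_ext' fun lam => LinearMap.ext_ring ?_
  change e r (f s (phi l lam)) - f s (e r (phi l lam)) =
    (if r = s then (qq - qq⁻¹)⁻¹ • (t r - tinv r) else 0 : Module.End KK (Fock l)) (phi l lam)
  have hef : e r (f s (phi l lam)) = ∑ p ∈ colorAddables sT lam s,
      ∑ p' ∈ colorRemovables sT (addNode lam p) r, addSubTerm sT r s lam p p' := by
    rw [apply_phi_eq_sum_addNode hf hf0, map_sum]
    refine Finset.sum_congr rfl fun p _ => ?_
    rw [map_smul, apply_phi_eq_sum_subNode hn he he0, Finset.smul_sum]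
    refine Finset.sum_congr rfl fun p' _ => ?_
    rw [smul_smul, ← zpow_add₀ qq_ne_zero, ← sub_eq_add_neg, addSubTerm]
  have hfe : f s (e r (phi l lam)) = ∑ p' ∈ colorRemovables sT lam r,
      ∑ p ∈ colorAddables sT (subNode lam p') s, subAddTerm sT r s lam p p' := by
    rw [apply_phi_eq_sum_subNode hn he he0, map_sum]
    refine Finset.sum_congr rfl fun p' _ => ?_
    rw [map_smul, apply_phi_eq_sum_addNode hf hf0, Finset.smul_sum]
    refine Finset.sum_congr rfl fun p _ => ?_
    rw [smul_smul, ← zpow_add₀ qq_ne_zero, neg_add_eq_sub, subAddTerm]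
  have hef' := hef.trans (Finset.sum_congr rfl fun p _ => sum_eq_ite_add_sum_erase _ p _)
  have hfe' := hfe.trans (Finset.sum_congr rfl fun p _ => sum_eq_ite_add_sum_erase _ p _)
  rw [Finset.sum_add_distrib, sum_addSubTerm_self hn, sum_addSubTerm_erase] at hef'
  rw [Finset.sum_add_distrib, sum_subAddTerm_self hn] at hfe'
  rw [hef', hfe', add_sub_add_right_eq_sub]
  split_ifs with hrs
  · rw [← sub_smul, ← linearCombination_boundary sT lam (fun x => if color n x = r then
      qq ^ (weightAbove n r x (boundary sT lam) - weightBelow n r x (boundary sT lam)) else 0),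
      linearCombination_boundary_zpow, LinearMap.smul_apply, LinearMap.sub_apply, ht, htinv,
      Nr_eq, mul_smul, sub_smul]
  · rw [sub_zero, LinearMap.zero_apply]
end
end

section
/- On the level-l q-deformed Fock space F, for all r, s ∈ ℤ/nℤ the operators satisfy t_r e_s t_r^{−1} = q^{a_{rs}} e_s and t_r f_s t_r^{−1} = q^{−a_{rs}} f_s, where a_{rs} = 2δ(r = s) − δ(s ≡ r + 1 mod n) − δ(s ≡ r − 1 mod n) is the Cartan matrix of affine type A^{(1)}_{n−1}. Equivalently, whenever μ_l/λ_l = s, one has N_r(μ_l) = N_r(λ_l) − a_{rs}. -/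
/-!
Shared setup for the level-`l` q-deformed Fock space of `U_q'(sl_n^)` with charge
`sT = (s_1, …, s_l)` (here `sT b` is the paper's `s_{b+1}`; rows and columns of
partitions are 0-indexed, so the node `(i, j, b)` of the paper is `(b, i-1, j-1)`).

* `Ptn` : partitions; `MPtn l` : `l`-multipartitions.
* `addableRow lam b i` : a node can be added to `lam` in component `b`, row `i`;
  the added node then lies in column `(lam b).1 i` and has `d`-value
  `addD sT lam b i = sT b + (lam b).1 i - i` and colour `(addD … : ZMod n)`.
* `removableRow lam b i` : a node can be removed in component `b`, row `i`;
  it has `d`-value `remD sT lam b i = sT b + (lam b).1 i - 1 - i`.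
* `nodeLt` : the total order `(d, b) < (d', b')` on nodes.
* `AddableSet/RemovableSet n l sT lam r` : positions of addable/removable
  `r`-nodes; `Nr` is `N_r(λ)`, and `Ngt/Nlt n l sT lam r γ` are
  `N_r^>(λ,μ)/N_r^<(λ,μ)` for the added node `γ = (d, b)`.
* `AddAt lam mu b i` : `mu` is obtained from `lam` by adding one node in component
  `b`, row `i`; `AddOne n l sT r lam mu` is the relation `μ/λ = r`.
* `Fock l = (MPtn l) →₀ ℚ(q)` with natural basis `phi l lam`; the operators
  `e r, f r, t r, t r ^{-1}` are characterized by their matrix entries in this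
  basis (hypotheses of the theorems below).
-/

noncomputable section

/-- the Cartan matrix `a_{rs}` of affine type `A^{(1)}_{n-1}`. -/
def cartan (n : ℕ) (r s : ZMod n) : ℤ :=
  (if r = s then 2 else 0) - (if s = r + 1 then 1 else 0) - (if s = r - 1 then 1 else 0)

open Classical in
/-- The number of addable nodes of colour `r` as a sum of indicators over the rows `0, …, M`. -/
theorem ncard_addableSet (n l : ℕ) (sT : Fin l → ℤ) (lam : MPtn l) (r : ZMod n) (M : ℕ)
    (hM : ∀ b, ∀ i ≥ M, (lam b).1 i = 0) :
    ((AddableSet n l sT lam r).ncard : ℤ) = ∑ b, ∑ i ∈ Finset.range (M + 1),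
      if addableRow lam b i ∧ ((addD sT lam b i : ℤ) : ZMod n) = r then 1 else 0 := by
  have h : AddableSet n l sT lam r =
      (((Finset.univ : Finset (Fin l)) ×ˢ Finset.range (M + 1)).filter fun p =>
        addableRow lam p.1 p.2 ∧ ((addD sT lam p.1 p.2 : ℤ) : ZMod n) = r : Finset _) := by
    ext ⟨b, i⟩
    simp only [AddableSet, Set.mem_ofPred_eq, Finset.coe_filter, Finset.mem_product,
      Finset.mem_univ, true_and, Finset.mem_range]
    refine ⟨fun h => ⟨?_, h⟩, fun h => h.2⟩
    by_contra! hi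
    rcases h.1 with h0 | h0
    · omega
    · rw [hM b (i - 1) (by omega)] at h0
      omega
  rw [h, Set.ncard_coe_finset, Finset.card_filter, Finset.sum_product]
  push_cast
  rfl

open Classical in
/-- The number of removable nodes of colour `r` as a sum of indicators over the rows
`0, …, M - 1`. -/
theorem ncard_removableSet (n l : ℕ) (sT : Fin l → ℤ) (lam : MPtn l) (r : ZMod n) (M : ℕ)
    (hM : ∀ b, ∀ i ≥ M, (lam b).1 i = 0) :
    ((RemovableSet n l sT lam r).ncard : ℤ) = ∑ b, ∑ i ∈ Finset.range M,
      if removableRow lam b i ∧ ((remD sT lam b i : ℤ) : ZMod n) = r then 1 else 0 := by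
  have h : RemovableSet n l sT lam r =
      (((Finset.univ : Finset (Fin l)) ×ˢ Finset.range M).filter fun p =>
        removableRow lam p.1 p.2 ∧ ((remD sT lam p.1 p.2 : ℤ) : ZMod n) = r : Finset _) := by
    ext ⟨b, i⟩
    simp only [RemovableSet, Set.mem_ofPred_eq, Finset.coe_filter, Finset.mem_product,
      Finset.mem_univ, true_and, Finset.mem_range]
    refine ⟨fun h => ⟨?_, h⟩, fun h => h.2⟩
    by_contra! hi
    have h0 := h.1
    rw [removableRow, hM b i hi] at h0
    omega
  rw [h, Set.ncard_coe_finset, Finset.card_filter, Finset.sum_product]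
  push_cast
  rfl

/-- `N_r(λ)` in terms of beta-numbers: rows that are neither addable nor removable contribute
terms that cancel, so the corner conditions can be dropped. -/
theorem Nr_eq_sum (n l : ℕ) (sT : Fin l → ℤ) (lam : MPtn l) (r : ZMod n) (M : ℕ)
    (hM : ∀ b, ∀ i ≥ M, (lam b).1 i = 0) :
    Nr n l sT lam r = ∑ b,
      ((∑ i ∈ Finset.range (M + 1), if ((addD sT lam b i : ℤ) : ZMod n) = r then 1 else 0) -
        ∑ i ∈ Finset.range M, if ((addD sT lam b i : ℤ) : ZMod n) = r + 1 then 1 else 0) := by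
  classical
  rw [Nr, ncard_addableSet n l sT lam r M hM, ncard_removableSet n l sT lam r M hM,
    ← Finset.sum_sub_distrib]
  refine Finset.sum_congr rfl fun b _ => ?_
  rw [Finset.sum_range_succ', Finset.sum_range_succ', add_sub_right_comm, add_sub_right_comm,
    ← Finset.sum_sub_distrib, ← Finset.sum_sub_distrib]
  congr 1
  · refine Finset.sum_congr rfl fun i _ => ?_
    have hrem : ((remD sT lam b i : ℤ) : ZMod n) = r ↔
        ((addD sT lam b i : ℤ) : ZMod n) = r + 1 := by
      rw [← sub_eq_iff_eq_add, remD, addD]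
      push_cast
      ring_nf
    by_cases hlt : (lam b).1 (i + 1) < (lam b).1 i
    · simp [addableRow, removableRow, hlt, hrem]
    · have heq : (lam b).1 (i + 1) = (lam b).1 i :=
        le_antisymm ((lam b).2.1 (Nat.le_succ i)) (not_lt.mp hlt)
      have hadd : addD sT lam b (i + 1) = remD sT lam b i := by
        rw [addD, remD, heq]
        push_cast
        ring
      simp [addableRow, removableRow, hlt, hadd, hrem]
  · simp [addableRow]

theorem MPtn.exists_bound {l : ℕ} (lam : MPtn l) : ∃ M : ℕ, ∀ b, ∀ i ≥ M, (lam b).1 i = 0 := by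
  choose N hN using fun b => (lam b).2.2
  exact ⟨Finset.univ.sup N, fun b i hi =>
    hN b i ((Finset.le_sup (Finset.mem_univ b)).trans hi)⟩

/-- Changing a function at a single point of a finite set changes its sum by the difference of
the two values there. -/
theorem Finset.sum_sub_sum_eq_of_ne {ι : Type*} {s : Finset ι} {f g : ι → ℤ} {k : ι}
    (hk : k ∈ s) (h : ∀ i ∈ s, i ≠ k → f i = g i) :
    ∑ i ∈ s, f i - ∑ i ∈ s, g i = f k - g k := by
  rw [← Finset.sum_sub_distrib]
  exact Finset.sum_eq_single_of_mem k hk fun i hi hne => sub_eq_zero.mpr (h i hi hne)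

theorem Nr_of_addOne (n l : ℕ) (sT : Fin l → ℤ) (r s : ZMod n) (lam mu : MPtn l)
    (h : AddOne n l sT s lam mu) : Nr n l sT mu r = Nr n l sT lam r - cartan n r s := by
  obtain ⟨b, k, ⟨hk, hrow, hcomp⟩, hs⟩ := h
  obtain ⟨M₁, hM₁⟩ := lam.exists_bound
  obtain ⟨M₂, hM₂⟩ := mu.exists_bound
  have hkM : k < max M₁ M₂ := by
    by_contra! hle
    have := hM₂ b k ((le_max_right _ _).trans hle)
    omega
  rw [Nr_eq_sum n l sT lam r (max M₁ M₂) fun b i hi => hM₁ b i ((le_max_left _ _).trans hi),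
    Nr_eq_sum n l sT mu r (max M₁ M₂) fun b i hi => hM₂ b i ((le_max_right _ _).trans hi)]
  have hne : ∀ i, i ≠ k → addD sT mu b i = addD sT lam b i := fun i hi => by
    rw [addD, addD, hrow i hi]
  have hother : ∀ b', b' ≠ b → ∀ i, addD sT mu b' i = addD sT lam b' i := fun b' hb' i => by
    rw [addD, addD, hcomp b' hb']
  have hmu : ((addD sT mu b k : ℤ) : ZMod n) = s + 1 := by
    rw [← hs, addD, addD, hk]
    push_cast
    ring
  rw [sub_eq_add_neg, ← sub_eq_iff_eq_add', Finset.sum_sub_sum_eq_of_ne (Finset.mem_univ b) fun b' _ hb' => by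
    simp only [hother b' hb'], sub_sub_sub_comm,
    Finset.sum_sub_sum_eq_of_ne (Finset.mem_range.mpr (hkM.trans (Nat.lt_succ_self _)))
      fun i _ hi => by rw [hne i hi],
    Finset.sum_sub_sum_eq_of_ne (Finset.mem_range.mpr hkM) fun i _ hi => by rw [hne i hi],
    hmu, hs, cartan]
  simp only [add_left_inj, eq_sub_iff_add_eq, eq_comm (a := r) (b := s)]
  split_ifs <;> norm_num

/-- Conjugating `x` by a diagonal operator with eigenvalues `q ^ N` scales `x` by `q ^ c`
whenever `N μ - N λ = c` at every nonzero matrix entry of `x` from `λ` to `μ`. -/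
theorem conj_diagonal {l : ℕ} (x t tinv : Module.End KK (Fock l)) (N : MPtn l → ℤ) (c : ℤ)
    (ht : ∀ lam, t (phi l lam) = qq ^ N lam • phi l lam)
    (htinv : ∀ lam, tinv (phi l lam) = qq ^ (-N lam) • phi l lam)
    (hx : ∀ lam mu, x (phi l lam) mu ≠ 0 → N mu - N lam = c) :
    t * x * tinv = qq ^ c • x := by
  have hq : qq ≠ 0 := RatFunc.X_ne_zero
  have htapply : ∀ (v : Fock l) (mu : MPtn l), t v mu = qq ^ N mu * v mu := by
    intro v mu
    induction v using Finsupp.induction_linear with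
    | zero => simp
    | add v w hv hw => rw [map_add, Finsupp.add_apply, Finsupp.add_apply, hv, hw, mul_add]
    | single lam a =>
      have hsingle : (Finsupp.single lam a : Fock l) = a • phi l lam := by
        simp [phi]
      rw [hsingle, map_smul, ht]
      by_cases hlm : lam = mu
      · subst hlm
        simp [phi, mul_comm]
      · simp [phi, Finsupp.single_eq_of_ne' hlm]
  refine Finsupp.lhom_ext' fun lam => LinearMap.ext_ring ?_
  change t (x (tinv (phi l lam))) = qq ^ c • x (phi l lam)
  rw [htinv, map_smul, map_smul]
  ext mu
  rw [Finsupp.smul_apply, Finsupp.smul_apply, htapply, smul_eq_mul, smul_eq_mul]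
  by_cases h0 : x (phi l lam) mu = 0
  · simp [h0]
  · rw [← mul_assoc, ← zpow_add₀ hq, ← hx lam mu h0, neg_add_eq_sub]

/-- `t_r e_s t_r⁻¹ = q^{a_{rs}} e_s` and `t_r f_s t_r⁻¹ = q^{-a_{rs}} f_s`
on the Fock space; equivalently, `μ/λ = s` implies `N_r(μ) = N_r(λ) - a_{rs}`. -/
theorem stmt_5 (n l : ℕ) (hn : 2 ≤ n) (hl : 1 ≤ l) (sT : Fin l → ℤ)
    (e f t tinv : ZMod n → Module.End KK (Fock l))
    (hf : ∀ (lam mu : MPtn l) (b : Fin l) (i : ℕ), AddAt lam mu b i →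
      f ((addD sT lam b i : ℤ) : ZMod n) (phi l lam) mu =
        qq ^ Ngt n l sT lam ((addD sT lam b i : ℤ) : ZMod n) (addD sT lam b i, b))
    (hf0 : ∀ (r : ZMod n) (lam mu : MPtn l), ¬ AddOne n l sT r lam mu →
      f r (phi l lam) mu = 0)
    (he : ∀ (lam mu : MPtn l) (b : Fin l) (i : ℕ), AddAt lam mu b i →
      e ((addD sT lam b i : ℤ) : ZMod n) (phi l mu) lam =
        qq ^ (- Nlt n l sT lam ((addD sT lam b i : ℤ) : ZMod n) (addD sT lam b i, b)))
    (he0 : ∀ (r : ZMod n) (lam mu : MPtn l), ¬ AddOne n l sT r lam mu →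
      e r (phi l mu) lam = 0)
    (ht : ∀ (r : ZMod n) (lam : MPtn l),
      t r (phi l lam) = qq ^ Nr n l sT lam r • phi l lam)
    (htinv : ∀ (r : ZMod n) (lam : MPtn l),
      tinv r (phi l lam) = qq ^ (- Nr n l sT lam r) • phi l lam) :
    (∀ r s : ZMod n,
      t r * e s * tinv r = qq ^ cartan n r s • e s ∧
      t r * f s * tinv r = qq ^ (- cartan n r s) • f s) ∧
    (∀ (r s : ZMod n) (lam mu : MPtn l), AddOne n l sT s lam mu →
      Nr n l sT mu r = Nr n l sT lam r - cartan n r s) := by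
  have hN := Nr_of_addOne n l sT
  refine ⟨fun r s => ⟨conj_diagonal _ _ _ (Nr n l sT · r) _ (ht r) (htinv r) fun mu lam h => ?_,
    conj_diagonal _ _ _ (Nr n l sT · r) _ (ht r) (htinv r) fun lam mu h => ?_⟩, hN⟩
  · have := hN r s lam mu (not_imp_comm.mp (he0 s lam mu) h)
    omega
  · have := hN r s lam mu (not_imp_comm.mp (hf0 s lam mu) h)
    omega
end
end
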